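/- Let q > 2 be a prime, d an odd square-free natural number, n ≤ 3, and H a semisimple factorizable Hopf algebra of dimension d·q^n over an algebraically closed field of characteristic 0. Then H is isomorphic to the dual group algebra k^G of a finite abelian group G of order d·q^n. -/

import Mathlib

open scoped TensorProduct

open scoped TensorProduct

section QuasiTriangular

variable (k : Type*) [Field k] (H : Type*) [Ring H] [HopfAlgebra k H]

/-- `ε ⊗ id : H ⊗ H → H` (after the canonical identification `k ⊗ H ≅ H`). -/
noncomputable def epsId : H ⊗[k] H →ₗ[k] H :=
  (TensorProduct.lid k H).toLinearMap ∘ₗ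
    TensorProduct.map (Coalgebra.counit : H →ₗ[k] k) LinearMap.id

/-- `id ⊗ ε : H ⊗ H → H` (after the canonical identification `H ⊗ k ≅ H`). -/
noncomputable def idEps : H ⊗[k] H →ₗ[k] H :=
  (TensorProduct.rid k H).toLinearMap ∘ₗ
    TensorProduct.map LinearMap.id (Coalgebra.counit : H →ₗ[k] k)

/-- the embedding of `H ⊗ H` into the first and third tensor factors of
`H ⊗ H ⊗ H`: `a ⊗ b ↦ a ⊗ 1 ⊗ b`. -/
noncomputable def leg13 : H ⊗[k] H →ₗ[k] (H ⊗[k] H) ⊗[k] H :=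
  TensorProduct.map ((TensorProduct.mk k H H).flip 1) LinearMap.id

/-- the embedding of `H ⊗ H` into the last two tensor factors of
`H ⊗ H ⊗ H`: `a ⊗ b ↦ 1 ⊗ a ⊗ b`. -/
noncomputable def leg23 : H ⊗[k] H →ₗ[k] (H ⊗[k] H) ⊗[k] H :=
  TensorProduct.map (TensorProduct.mk k H H 1) LinearMap.id

/-- the embedding of `H ⊗ H` into the first two tensor factors of
`H ⊗ H ⊗ H`: `x ↦ x ⊗ 1`. -/
noncomputable def leg12 : H ⊗[k] H →ₗ[k] (H ⊗[k] H) ⊗[k] H :=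
  (TensorProduct.mk k (H ⊗[k] H) H).flip 1

/-- `Δ ⊗ id : H ⊗ H → H ⊗ H ⊗ H` for a comultiplication `Δ`. -/
noncomputable def deltaRight (D : H →ₗ[k] H ⊗[k] H) :
    H ⊗[k] H →ₗ[k] (H ⊗[k] H) ⊗[k] H :=
  TensorProduct.map D LinearMap.id

/-- `id ⊗ Δ : H ⊗ H → H ⊗ H ⊗ H` for a comultiplication `Δ`. -/
noncomputable def deltaLeft (D : H →ₗ[k] H ⊗[k] H) :
    H ⊗[k] H →ₗ[k] (H ⊗[k] H) ⊗[k] H :=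
  (TensorProduct.assoc k H H H).symm.toLinearMap ∘ₗ TensorProduct.map LinearMap.id D

variable {k H} in
/-- `R ∈ H ⊗ H` is an R-matrix for `H` endowed with the comultiplication `D`
(and the counit of `H`): `R` is invertible and satisfies (QT1)–(QT4).
(QT4) `Δ^cop(h) = R Δ(h) R⁻¹` is stated in the equivalent form
`Δ^cop(h) * R = R * Δ(h)`. -/
noncomputable def IsRMatrixFor (D : H →ₗ[k] H ⊗[k] H) (R : H ⊗[k] H) : Prop :=
  IsUnit R ∧
  deltaRight k H D R = leg13 k H R * leg23 k H R ∧
  deltaLeft k H D R = leg13 k H R * leg12 k H R ∧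
  epsId k H R = 1 ∧ idEps k H R = 1 ∧
  ∀ h : H, (TensorProduct.comm k H H) (D h) * R = R * D h

variable {k H} in
/-- The comultiplication `h ↦ A⁻¹ · D(h) · A` obtained by conjugating the
comultiplication `D` by an (invertible) element `A ∈ H ⊗ H`; for a twist `J`
this is the twisted comultiplication `Δ^J`. -/
noncomputable def conjComul (D : H →ₗ[k] H ⊗[k] H) (A : H ⊗[k] H) :
    H →ₗ[k] H ⊗[k] H :=
  LinearMap.mulLeft k (Ring.inverse A) ∘ₗ LinearMap.mulRight k A ∘ₗ D

variable {k H} in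
/-- `J ∈ H ⊗ H` is a twist for `H` endowed with the comultiplication `D`:
`J` is invertible, `(ε ⊗ id)(J) = (id ⊗ ε)(J) = 1` and
`(Δ ⊗ id)(J)(J ⊗ 1) = (id ⊗ Δ)(J)(1 ⊗ J)`. -/
noncomputable def IsTwistFor (D : H →ₗ[k] H ⊗[k] H) (J : H ⊗[k] H) : Prop :=
  IsUnit J ∧ epsId k H J = 1 ∧ idEps k H J = 1 ∧
  deltaRight k H D J * leg12 k H J = deltaLeft k H D J * leg23 k H J

end QuasiTriangular

/-- The comultiplication of the dual group algebra `k^G = (G → k)` of a finite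
group `G`: the dual of the multiplication map `G × G → G`, via the canonical
identification `(G → k) ⊗ (G → k) ≅ (G × G → k)`. -/
noncomputable def dualComul (k : Type*) [Field k] (G : Type*) [Monoid G]
    [Fintype G] : (G → k) →ₗ[k] (G → k) ⊗[k] (G → k) :=
  (TensorProduct.congr (Finsupp.linearEquivFunOnFinite k k G)
      (Finsupp.linearEquivFunOnFinite k k G)).toLinearMap ∘ₗ
    (finsuppTensorFinsupp' k G G).symm.toLinearMap ∘ₗ
    (Finsupp.linearEquivFunOnFinite k k (G × G)).symm.toLinearMap ∘ₗ
    LinearMap.funLeft k k (fun p : G × G => p.1 * p.2)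

/-- `e : H ≃ k^G` is an isomorphism of Hopf algebras: an algebra isomorphism
from `H` to the dual group algebra `(G → k)` which intertwines the
comultiplication of `H` with that of `k^G` and the counit of `H` with that of
`k^G` (evaluation at `1`). -/
noncomputable def IsDualGroupAlgebraIso (k : Type*) [Field k] (H : Type*)
    [Ring H] [HopfAlgebra k H] (G : Type*) [Monoid G] [Fintype G]
    (e : H ≃ₐ[k] (G → k)) : Prop :=
  (∀ x : H, TensorProduct.map e.toLinearMap e.toLinearMap (Coalgebra.comul x) =
      dualComul k G (e x)) ∧
  ∀ x : H, Coalgebra.counit (R := k) x = e x 1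


section PartA
open scoped TensorProduct
open WithConv Coalgebra HopfAlgebra

namespace FH

section basic
variable {k : Type*} [Field k] {H : Type*} [Ring H] [HopfAlgebra k H]
variable {A : Type*} [Ring A] [Algebra k A] {B : Type*} [Ring B] [Algebra k B]

/-- convolution product of linear maps -/
noncomputable def cv (f g : H →ₗ[k] A) : H →ₗ[k] A := (toConv f * toConv g).ofConv

/-- the convolution unit -/
noncomputable def cu (k H A : Type*) [Field k] [Ring H] [HopfAlgebra k H] [Ring A] [Algebra k A] :
    H →ₗ[k] A := Algebra.linearMap k A ∘ₗ counit

lemma cu_apply (x : H) : cu k H A x = algebraMap k A (counit x) := rfl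

lemma cv_apply (f g : H →ₗ[k] A) (x : H) :
    cv f g x = ∑ i ∈ (ℛ k x).index, f ((ℛ k x).left i) * g ((ℛ k x).right i) :=
  (ℛ k x).convMul_apply _ _

lemma cv_eq (f g : H →ₗ[k] A) (x : H) :
    cv f g x = LinearMap.mul' k A (TensorProduct.map f g (comul x)) := rfl

lemma cv_assoc (f g h : H →ₗ[k] A) : cv (cv f g) h = cv f (cv g h) := by
  simp [cv, mul_assoc]

lemma cv_cu (f : H →ₗ[k] A) : cv f (cu k H A) = f := by
  change (toConv f * 1).ofConv = f
  simp

lemma cu_cv (f : H →ₗ[k] A) : cv (cu k H A) f = f := by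
  change (1 * toConv f).ofConv = f
  simp

lemma cv_id_S : cv (LinearMap.id : H →ₗ[k] H) (antipode k) = cu k H H := by
  rw [cv, LinearMap.id_mul_antipode]; rfl

lemma cv_S_id : cv (antipode k) (LinearMap.id : H →ₗ[k] H) = cu k H H := by
  rw [cv, LinearMap.antipode_mul_id]; rfl

lemma comp_cv (φ : A →ₐ[k] B) (f g : H →ₗ[k] A) :
    φ.toLinearMap ∘ₗ cv f g = cv (φ.toLinearMap ∘ₗ f) (φ.toLinearMap ∘ₗ g) := by
  ext x; simp [cv_apply]

lemma comp_cu (φ : A →ₐ[k] B) : φ.toLinearMap ∘ₗ cu k H A = cu k H B := by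
  ext x; simp [cu_apply]

lemma alg_cv_S (φ : H →ₐ[k] A) :
    cv φ.toLinearMap (φ.toLinearMap ∘ₗ antipode k) = cu k H A := by
  have := comp_cv φ LinearMap.id (antipode k)
  rw [cv_id_S, comp_cu] at this
  rw [this]; rfl

lemma alg_S_cv (φ : H →ₐ[k] A) :
    cv (φ.toLinearMap ∘ₗ antipode k) φ.toLinearMap = cu k H A := by
  have := comp_cv φ (antipode k) LinearMap.id
  rw [cv_S_id, comp_cu] at this
  rw [this]; rfl

lemma cv_inv_unique {f g h : H →ₗ[k] A} (h1 : cv f g = cu k H A) (h2 : cv g h = cu k H A) :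
    f = h := by
  rw [← cv_cu f, ← h2, ← cv_assoc, h1, cu_cv]

/-- `x ↦ x ⊗ 1` -/
noncomputable def i1 : H →ₐ[k] H ⊗[k] H := Algebra.TensorProduct.includeLeft
/-- `x ↦ 1 ⊗ x` -/
noncomputable def i2 : H →ₐ[k] H ⊗[k] H := Algebra.TensorProduct.includeRight
/-- comultiplication as an algebra map -/
noncomputable def dl : H →ₐ[k] H ⊗[k] H := Bialgebra.comulAlgHom k H

lemma i1_apply (x : H) : i1 (k := k) x = x ⊗ₜ 1 := rfl
lemma i2_apply (x : H) : i2 (k := k) x = 1 ⊗ₜ x := rfl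
lemma dl_apply (x : H) : dl (k := k) x = comul x := rfl

lemma dl_eq : cv (i1 (k := k) (H := H)).toLinearMap (i2 (k := k) (H := H)).toLinearMap
    = (dl (k := k) (H := H)).toLinearMap := by
  ext x
  rw [cv_apply]
  simp only [AlgHom.toLinearMap_apply, i1_apply, i2_apply, Algebra.TensorProduct.tmul_mul_tmul,
    mul_one, one_mul, dl_apply]
  exact (ℛ k x).eq

/-- G1 -/
lemma G1 : cv (dl (k := k) (H := H)).toLinearMap (i2.toLinearMap ∘ₗ antipode k) = i1.toLinearMap := by
  rw [← dl_eq, cv_assoc, alg_cv_S, cv_cu]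

lemma G2 : cv (i1.toLinearMap ∘ₗ antipode k) (dl (k := k) (H := H)).toLinearMap = i2.toLinearMap := by
  rw [← dl_eq, ← cv_assoc, alg_S_cv, cu_cv]

lemma dl_S : (dl (k := k) (H := H)).toLinearMap ∘ₗ antipode k
    = cv (i2.toLinearMap ∘ₗ antipode k) (i1.toLinearMap ∘ₗ antipode k) := by
  refine cv_inv_unique (g := (dl (k := k) (H := H)).toLinearMap) (alg_S_cv _) ?_
  rw [← dl_eq, cv_assoc, ← cv_assoc i2.toLinearMap, alg_cv_S, cu_cv, alg_cv_S]

lemma comul_S (x : H) : comul (R := k) (antipode k x) =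
    TensorProduct.comm k H H (TensorProduct.map (antipode k) (antipode k) (comul (R := k) x)) := by
  have := LinearMap.congr_fun (dl_S (k := k) (H := H)) x
  rw [LinearMap.comp_apply, AlgHom.toLinearMap_apply, dl_apply] at this
  rw [this, cv_apply]
  conv_rhs => rw [← (ℛ k x).eq]
  simp [i1_apply, i2_apply]

lemma comul_SS (x : H) : comul (R := k) (antipode k (antipode k x)) =
    TensorProduct.map (antipode k ∘ₗ antipode k) (antipode k ∘ₗ antipode k) (comul (R := k) x) := by
  rw [comul_S, comul_S]
  conv_lhs => rw [← (ℛ k x).eq]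
  conv_rhs => rw [← (ℛ k x).eq]
  simp

lemma counit_S (x : H) : counit (R := k) (antipode k x) = counit (R := k) x := by
  simp

/-- coalgebra-map precomposition for functionals: `(fg)∘S = (gS)(fS)`. -/
lemma cv_comp_S (f g : H →ₗ[k] k) : cv f g ∘ₗ antipode k = cv (g ∘ₗ antipode k) (f ∘ₗ antipode k) := by
  ext x
  rw [LinearMap.comp_apply, cv_eq, comul_S, cv_apply]
  conv_lhs => rw [← (ℛ k x).eq]
  simp [mul_comm]

lemma cv_comp_SS (f g : H →ₗ[k] A) : cv f g ∘ₗ (antipode k ∘ₗ antipode k) =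
    cv (f ∘ₗ (antipode k ∘ₗ antipode k)) (g ∘ₗ (antipode k ∘ₗ antipode k)) := by
  ext x
  rw [LinearMap.comp_apply, LinearMap.comp_apply, cv_eq, comul_SS, cv_apply]
  conv_lhs => rw [← (ℛ k x).eq]
  simp

/-- slices -/
noncomputable def sl (f : H →ₗ[k] k) : H ⊗[k] H →ₗ[k] H :=
  (TensorProduct.lid k H).toLinearMap ∘ₗ TensorProduct.map f LinearMap.id

noncomputable def sr (f : H →ₗ[k] k) : H ⊗[k] H →ₗ[k] H :=
  (TensorProduct.rid k H).toLinearMap ∘ₗ TensorProduct.map LinearMap.id f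

@[simp] lemma sl_tmul (f : H →ₗ[k] k) (a b : H) : sl f (a ⊗ₜ b) = f a • b := by simp [sl]
@[simp] lemma sr_tmul (f : H →ₗ[k] k) (a b : H) : sr f (a ⊗ₜ b) = f b • a := by simp [sr]

lemma sl_mul_i2 (f : H →ₗ[k] k) (t : H ⊗[k] H) (y : H) : sl f (t * 1 ⊗ₜ y) = sl f t * y := by
  induction t with
  | zero => simp
  | tmul a b => simp
  | add a b ha hb => simp [add_mul, ha, hb]

lemma sl_i2_mul (f : H →ₗ[k] k) (t : H ⊗[k] H) (y : H) : sl f ((1 ⊗ₜ y) * t) = y * sl f t := by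
  induction t with
  | zero => simp
  | tmul a b => simp
  | add a b ha hb => simp [mul_add, ha, hb]

lemma f_sl (f g : H →ₗ[k] k) (x : H) : g (sl f (comul x)) = cv f g x := by
  rw [cv_apply]
  conv_lhs => rw [← (ℛ k x).eq]
  simp

lemma f_sr (f g : H →ₗ[k] k) (x : H) : g (sr f (comul x)) = cv g f x := by
  rw [cv_apply]
  conv_lhs => rw [← (ℛ k x).eq]
  simp [mul_comm]

lemma cv_one_apply (f g : H →ₗ[k] A) : cv f g 1 = f 1 * g 1 := by
  rw [cv_eq]; simp [Algebra.TensorProduct.one_def]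

/-- points of H are separated by functionals -/
lemma dual_ext {x y : H} (h : ∀ f : H →ₗ[k] k, f x = f y) : x = y := by
  have : ∀ f : Module.Dual k H, f (x - y) = 0 := fun f => by rw [map_sub, h f, sub_self]
  exact sub_eq_zero.1 ((Module.forall_dual_apply_eq_zero_iff k _).1 this)

end basic
end FH

end PartA

section PartB
open scoped TensorProduct
open WithConv Coalgebra HopfAlgebra

namespace FH

section integrals
variable {k : Type*} [Field k] {H : Type*} [Ring H] [HopfAlgebra k H]
variable {A : Type*} [Ring A] [Algebra k A]

lemma exists_left_integral {A : Type*} [Ring A] [Algebra k A] [IsSemisimpleRing A] (e : A →ₐ[k] k) :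
    ∃ L : A, e L = 1 ∧ ∀ x, x * L = e x • L := by
  let K : Submodule A A := RingHom.ker e.toRingHom
  obtain ⟨J, hJ⟩ := exists_isCompl K
  have h1 : (1 : A) ∈ K ⊔ J := by rw [hJ.sup_eq_top]; trivial
  obtain ⟨a, ha, L, hL, hs⟩ := Submodule.mem_sup.1 h1
  have ha' : e a = 0 := ha
  have heL : e L = 1 := by
    have := congrArg e hs
    simpa [ha'] using this
  refine ⟨L, heL, fun x => ?_⟩
  have hmem : x * L - e x • L ∈ K ⊓ J := by
    refine ⟨?_, ?_⟩
    · change e (x * L - e x • L) = 0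
      simp [heL]
    · refine J.sub_mem (J.smul_mem x hL) ?_
      rw [Algebra.smul_def]
      exact J.smul_mem _ hL
  rw [hJ.inf_eq_bot] at hmem
  exact sub_eq_zero.1 hmem

lemma exists_integral [IsSemisimpleRing H] :
    ∃ L : H, counit (R := k) L = 1 ∧ (∀ x, x * L = counit (R := k) x • L) ∧
      (∀ x, L * x = counit (R := k) x • L) := by
  obtain ⟨L, h1, h2⟩ := exists_left_integral (Bialgebra.counitAlgHom k H)
  let e' : Hᵐᵒᵖ →ₐ[k] k := AlgHom.ofLinearMap
    (counit ∘ₗ (MulOpposite.opLinearEquiv k).symm.toLinearMap) (by simp)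
    (fun x y => by simp [mul_comm])
  have he' : ∀ x, e' x = counit (R := k) x.unop := fun x => rfl
  obtain ⟨M, h3, h4⟩ := exists_left_integral e'
  have hM : ∀ x, M.unop * x = counit (R := k) x • M.unop := by
    intro x
    have := congrArg MulOpposite.unop (h4 (MulOpposite.op x))
    simpa [he'] using this
  have heq : M.unop = L := by
    have a1 := h2 M.unop
    have a2 := hM L
    rw [he'] at h3
    simp only [Bialgebra.counitAlgHom_apply] at h1 a1
    rw [h3, one_smul] at a1
    rw [h1, one_smul] at a2
    exact a2.symm.trans a1
  exact ⟨L, h1, h2, by rw [← heq]; exact hM⟩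

lemma mul_cv_congr {a : A} {f f' g : H →ₗ[k] A} (h : ∀ x, a * f x = a * f' x) (x : H) :
    a * cv f g x = a * cv f' g x := by
  simp only [cv_apply, Finset.mul_sum, ← mul_assoc, h]

lemma cv_mul_congr {a : A} {f g g' : H →ₗ[k] A} (h : ∀ x, g x * a = g' x * a) (x : H) :
    cv f g x * a = cv f g' x * a := by
  simp only [cv_apply, Finset.sum_mul, mul_assoc, h]

end integrals

section frob
variable {k : Type*} [Field k] {H : Type*} [Ring H] [HopfAlgebra k H]

/-- two sided normalised integral -/
structure IsInt (k : Type*) [Field k] {H : Type*} [Ring H] [HopfAlgebra k H] (L : H) : Prop where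
  one : counit (R := k) L = 1
  left : ∀ x, x * L = counit (R := k) x • L
  right : ∀ x, L * x = counit (R := k) x • L

/-- normalised functional integral -/
structure IsCoint (lam : H →ₗ[k] k) : Prop where
  one : lam 1 = 1
  inv : ∀ g : H →ₗ[k] k, cv lam g = g 1 • lam

variable {L : H} (hL : IsInt k L) {lam : H →ₗ[k] k} (hl : IsCoint lam)

include hl in
lemma coint_sl (x : H) : sl lam (comul x) = lam x • (1 : H) := by
  refine dual_ext (k := k) fun g => ?_
  rw [f_sl, hl.inv]; simp [mul_comm]

include hL in
lemma int_right (x : H) : comul (R := k) L * (x ⊗ₜ 1) = comul (R := k) L * (1 ⊗ₜ antipode k x) := by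
  have h := LinearMap.congr_fun (G1 (k := k) (H := H)) x
  change _ = (x ⊗ₜ[k] (1:H)) at h
  rw [← h, mul_cv_congr (f' := cu k H (H ⊗[k] H)), cu_cv]
  · rfl
  · intro y
    simp only [AlgHom.toLinearMap_apply, dl_apply, ← Bialgebra.comul_mul, hL.right, cu_apply, map_smul]
    rw [← Algebra.commutes, ← Algebra.smul_def]

include hL in
lemma int_left (x : H) : (1 ⊗ₜ x) * comul (R := k) L = (antipode k x ⊗ₜ 1) * comul (R := k) L := by
  have h := LinearMap.congr_fun (G2 (k := k) (H := H)) x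
  change _ = ((1:H) ⊗ₜ[k] x) at h
  rw [← h, cv_mul_congr (g' := cu k H (H ⊗[k] H)), cv_cu]
  · rfl
  · intro y
    simp only [AlgHom.toLinearMap_apply, dl_apply, ← Bialgebra.comul_mul, hL.left, cu_apply, map_smul]
    rw [← Algebra.smul_def]

include hL hl in
lemma eq_i (x : H) : sl lam (comul (R := k) L * (x ⊗ₜ 1)) = lam L • antipode k x := by
  rw [int_right hL, sl_mul_i2, coint_sl hl]; simp

include hL hl in
lemma eq_ii (x : H) : sl lam ((antipode k x ⊗ₜ 1) * comul (R := k) L) = lam L • x := by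
  rw [← int_left hL, sl_i2_mul, coint_sl hl]; simp

/-- `U_p(y) = y₁ p(y₂)` -/
noncomputable def U (p : H →ₗ[k] k) : H →ₗ[k] H := cv LinearMap.id (Algebra.linearMap k H ∘ₗ p)

lemma U_apply (p : H →ₗ[k] k) (x : H) : U p x = sr p (comul x) := by
  rw [U, cv_apply]
  conv_rhs => rw [← (ℛ k x).eq]
  simp [Algebra.smul_def, Algebra.commutes]

lemma smulalg_cv (p r : H →ₗ[k] k) : cv (Algebra.linearMap k H ∘ₗ p) (Algebra.linearMap k H ∘ₗ r)
    = Algebra.linearMap k H ∘ₗ cv p r := (comp_cv (Algebra.ofId k H) p r).symm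

lemma U_comp (p r : H →ₗ[k] k) : U p ∘ₗ U r = U (cv p r) := by
  have : ∀ (f : H →ₗ[k] H), f ∘ₗ U r = cv f (Algebra.linearMap k H ∘ₗ r) := by
    intro f; ext x
    rw [LinearMap.comp_apply, U, cv_apply, cv_apply, map_sum]
    refine Finset.sum_congr rfl fun i _ => ?_
    simp only [LinearMap.comp_apply, Algebra.linearMap_apply, LinearMap.id_apply]
    rw [← Algebra.commutes, ← Algebra.commutes, ← Algebra.smul_def, ← Algebra.smul_def, map_smul]
  rw [this, U, cv_assoc, smulalg_cv, U]

lemma comp_U (f : H →ₗ[k] H) (r : H →ₗ[k] k) : f ∘ₗ U r = cv f (Algebra.linearMap k H ∘ₗ r) := by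
    ext x
    rw [LinearMap.comp_apply, U, cv_apply, cv_apply, map_sum]
    refine Finset.sum_congr rfl fun i _ => ?_
    simp only [LinearMap.comp_apply, Algebra.linearMap_apply, LinearMap.id_apply]
    rw [← Algebra.commutes, ← Algebra.commutes, ← Algebra.smul_def, ← Algebra.smul_def, map_smul]

lemma id_cv_SU (p : H →ₗ[k] k) : cv LinearMap.id (antipode k ∘ₗ U p) = Algebra.linearMap k H ∘ₗ p := by
  rw [comp_U, ← cv_assoc, cv_id_S, cu_cv]

variable [FiniteDimensional k H]
set_option linter.unusedSectionVars false

include hL hl in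
/-- trace formula -/
lemma trace_TS (T : H →ₗ[k] H) : lam L * LinearMap.trace k H (T ∘ₗ antipode k) =
    lam (cv LinearMap.id T L) := by
  have : lam L • (T ∘ₗ antipode k) = ∑ i ∈ (ℛ k L).index,
      LinearMap.smulRight (lam ∘ₗ LinearMap.mulLeft k ((ℛ k L).left i)) (T ((ℛ k L).right i)) := by
    ext x
    rw [LinearMap.smul_apply, LinearMap.comp_apply, ← map_smul, ← eq_i hL hl]
    conv_lhs => rw [← (ℛ k L).eq]
    simp [Finset.sum_mul]
  rw [← smul_eq_mul, ← map_smul, this, map_sum, cv_apply, map_sum]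
  refine Finset.sum_congr rfl fun i _ => ?_
  rw [LinearMap.trace_smulRight]
  simp

include hL hl in
lemma trace_USS (p : H →ₗ[k] k) :
    lam L * LinearMap.trace k H (U p ∘ₗ (antipode k ∘ₗ antipode k)) = p L := by
  have h := trace_TS hL hl (antipode k ∘ₗ U p)
  rw [id_cv_SU, LinearMap.comp_assoc, LinearMap.trace_comp_comm', LinearMap.comp_assoc] at h
  rw [h]
  simp [Algebra.algebraMap_eq_smul_one, hl.one]

lemma U_counit : U (counit : H →ₗ[k] k) = LinearMap.id := cv_cu _

include hL hl in
lemma trace_SS : lam L * LinearMap.trace k H (antipode k ∘ₗ antipode k) = 1 := by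
  have := trace_USS hL hl counit
  rwa [U_counit, LinearMap.id_comp, hL.one] at this

include hL hl in
lemma lamL_ne : lam L ≠ 0 := fun h => by
  have := trace_SS hL hl
  simp [h] at this

include hL hl in
lemma trace_USS' (p : H →ₗ[k] k) :
    LinearMap.trace k H (U p ∘ₗ (antipode k ∘ₗ antipode k)) =
      p L * LinearMap.trace k H (antipode k ∘ₗ antipode k) := by
  apply mul_left_cancel₀ (lamL_ne hL hl)
  rw [trace_USS hL hl, mul_left_comm, trace_SS hL hl, mul_one]

include hL hl in
lemma S_inj : Function.Injective (antipode k : H →ₗ[k] H) := by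
  rw [injective_iff_map_eq_zero]
  intro x hx
  have := eq_ii hL hl x
  rw [hx] at this
  simpa [lamL_ne hL hl] using this.symm

include hL hl in
lemma S_surj : Function.Surjective (antipode k : H →ₗ[k] H) :=
  LinearMap.surjective_of_injective (S_inj hL hl)

include hL hl in
/-- nondegeneracy -/
lemma lam_nondeg {x : H} (h : ∀ y, lam (x * y) = 0) : x = 0 := by
  obtain ⟨x', rfl⟩ := S_surj hL hl x
  have := eq_ii hL hl x'
  rw [← (ℛ k L).eq] at this
  simp only [Finset.mul_sum, Algebra.TensorProduct.tmul_mul_tmul, map_sum, sl_tmul, h, zero_smul,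
    Finset.sum_const_zero] at this
  have := (smul_eq_zero.1 this.symm).resolve_left (lamL_ne hL hl)
  rw [this, map_zero]

include hL hl in
lemma lam_nondeg' {x : H} (h : ∀ y, lam (y * x) = 0) : x = 0 := by
  have := eq_i hL hl x
  rw [← (ℛ k L).eq] at this
  simp only [Finset.sum_mul, Algebra.TensorProduct.tmul_mul_tmul, map_sum, sl_tmul, h, zero_smul,
    Finset.sum_const_zero] at this
  have := (smul_eq_zero.1 this.symm).resolve_left (lamL_ne hL hl)
  exact S_inj hL hl (by rw [this, map_zero])

include hL hl in
/-- for every functional `g`, `y ↦ λ(yx)` -/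
lemma Nak (x y : H) : lam (y * x) = lam (antipode k (antipode k x) * y) := by
  -- every y is of the form sr f (comul L)
  have key : ∀ f : H →ₗ[k] k, lam (sr f (comul L) * x) = lam (antipode k (antipode k x) * sr f (comul L)) := by
    intro f
    have h1 : lam (sr f (comul L) * x) = f (sl lam (comul (R := k) L * (x ⊗ₜ 1))) := by
      rw [← (ℛ k L).eq]; simp [Finset.sum_mul, mul_comm]
    have h2 : lam (antipode k (antipode k x) * sr f (comul L)) =
        f (sl lam ((antipode k (antipode k x) ⊗ₜ 1) * comul (R := k) L)) := by
      rw [← (ℛ k L).eq]; simp [Finset.mul_sum, mul_comm]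
    rw [h1, h2, eq_i hL hl, eq_ii hL hl]
  have surj : Function.Surjective (fun f : Module.Dual k H => sr f (comul (R := k) L)) := by
    let φ : Module.Dual k H →ₗ[k] H :=
      { toFun := fun f => sr f (comul (R := k) L)
        map_add' := fun f g => by
          rw [← (ℛ k L).eq]; simp [add_smul, Finset.sum_add_distrib]
        map_smul' := fun c f => by
          rw [← (ℛ k L).eq]; simp [Finset.smul_sum, mul_smul] }
    have hinj : Function.Injective φ := by
      rw [injective_iff_map_eq_zero]
      intro f hf
      ext z
      have h2 : lam (antipode k z * sr f (comul L)) =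
          f (sl lam ((antipode k z ⊗ₜ 1) * comul (R := k) L)) := by
        rw [← (ℛ k L).eq]; simp [Finset.mul_sum, mul_comm]
      have hf' : sr f (comul L) = 0 := hf
      rw [hf', eq_ii hL hl] at h2
      simpa [lamL_ne hL hl] using h2.symm
    exact (LinearMap.injective_iff_surjective_of_finrank_eq_finrank
      (Subspace.dual_finrank_eq)).1 hinj
  obtain ⟨f, rfl⟩ := surj y
  exact key f

include hL hl in
lemma lam_S (x : H) : lam (antipode k x) = lam x := by
  have h1 : cv lam (lam ∘ₗ antipode k) = lam := by rw [hl.inv]; simp [hl.one]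
  let Se : H ≃ₗ[k] H := LinearEquiv.ofBijective (antipode k) ⟨S_inj hL hl, S_surj hL hl⟩
  let g : H →ₗ[k] k := lam ∘ₗ Se.symm.toLinearMap
  have hg : g ∘ₗ antipode k = lam := by
    ext y; exact congrArg lam (Se.symm_apply_apply y)
  have hg1 : g 1 = 1 := by
    have := LinearMap.congr_fun hg 1
    simpa [hl.one] using this
  have h2 : cv (g ∘ₗ antipode k) (lam ∘ₗ antipode k) = lam ∘ₗ antipode k := by
    rw [← cv_comp_S, hl.inv, hg1, one_smul]
  rw [hg, h1] at h2
  exact (LinearMap.congr_fun h2 x).symm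

include hL hl in
lemma S_four (y : H) : antipode k (antipode k (antipode k (antipode k y))) = y := by
  rw [← sub_eq_zero]
  apply lam_nondeg hL hl
  intro x
  rw [sub_mul, map_sub, sub_eq_zero]
  have e1 : lam (y * x) = lam (antipode k x * antipode k y) := by
    rw [← antipode_mul_antidistrib, lam_S hL hl]
  rw [e1, Nak hL hl (antipode k y) (antipode k x), ← antipode_mul_antidistrib, lam_S hL hl,
    Nak hL hl _ x]

/-- regular character -/
noncomputable def creg (k H : Type*) [Field k] [Ring H] [Algebra k H] : H →ₗ[k] k :=
  LinearMap.trace k H ∘ₗ LinearMap.mul k H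

lemma creg_apply (x : H) : creg k H x = LinearMap.trace k H (LinearMap.mulLeft k x) := rfl

omit [FiniteDimensional k H] in
include hL in
lemma creg_L' [FiniteDimensional k H] : creg k H L = 1 := by
  rw [creg_apply]
  have : LinearMap.mulLeft k L = LinearMap.smulRight (counit : H →ₗ[k] k) L := by
    ext x; simp [hL.right]
  rw [this, LinearMap.trace_smulRight, hL.one]

lemma creg_one : creg k H 1 = (Module.finrank k H : k) := by
  rw [creg_apply]; simp

lemma creg_mul_comm (x y : H) : creg k H (x * y) = creg k H (y * x) := by
  rw [creg_apply, creg_apply, LinearMap.mulLeft_mul, LinearMap.mulLeft_mul, LinearMap.trace_comp_comm']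

lemma creg_autom (φ : H ≃ₐ[k] H) (x : H) : creg k H (φ x) = creg k H x := by
  rw [creg_apply, creg_apply, ← LinearMap.trace_conj' (LinearMap.mulLeft k x) φ.toLinearEquiv]
  congr 1
  ext y
  simp [LinearEquiv.conj_apply]

lemma creg_sq : cv (creg k H) (creg k H) = (Module.finrank k H : k) • creg k H := by
  let β : H ⊗[k] H →ₗ[k] H ⊗[k] H :=
    TensorProduct.lift (LinearMap.mk₂ k (fun x y => comul (R := k) x * (1 ⊗ₜ y))
      (by intros; simp [add_mul]) (by intros; simp)
      (by intros; simp [TensorProduct.tmul_add, mul_add]) (by intros; simp))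
  have hβ : ∀ x y, β (x ⊗ₜ y) = comul (R := k) x * (1 ⊗ₜ y) := fun x y => by simp [β]
  have hsurj : Function.Surjective β := by
    rw [← LinearMap.range_eq_top, eq_top_iff]
    rintro t -
    induction t with
    | zero => exact zero_mem _
    | add a b ha hb => exact add_mem ha hb
    | tmul x y =>
      refine ⟨∑ i ∈ (ℛ k x).index, (ℛ k x).left i ⊗ₜ (antipode k ((ℛ k x).right i) * y), ?_⟩
      have h := LinearMap.congr_fun (G1 (k := k) (H := H)) x
      rw [cv_apply] at h
      have h' := congrArg (· * ((1 : H) ⊗ₜ[k] y)) h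
      simp only [Finset.sum_mul, AlgHom.toLinearMap_apply, LinearMap.comp_apply, i1_apply, i2_apply,
        dl_apply, Algebra.TensorProduct.tmul_mul_tmul, mul_assoc, one_mul, mul_one] at h'
      rw [map_sum, ← h']
      exact Finset.sum_congr rfl fun i _ => hβ _ _
  let βe : (H ⊗[k] H) ≃ₗ[k] (H ⊗[k] H) :=
    LinearEquiv.ofBijective β ⟨LinearMap.injective_iff_surjective.2 hsurj, hsurj⟩
  ext h
  have e1 : cv (creg k H) (creg k H) h = LinearMap.trace k (H ⊗[k] H) (LinearMap.mulLeft k (comul (R := k) h)) := by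
    rw [cv_apply]
    conv_rhs => rw [← (ℛ k h).eq]
    have : LinearMap.mulLeft k (∑ i ∈ (ℛ k h).index, (ℛ k h).left i ⊗ₜ[k] (ℛ k h).right i) =
        ∑ i ∈ (ℛ k h).index, TensorProduct.map (LinearMap.mulLeft k ((ℛ k h).left i))
          (LinearMap.mulLeft k ((ℛ k h).right i)) := by
      ext x y
      simp [Finset.sum_mul]
    rw [this, map_sum]
    refine Finset.sum_congr rfl fun i _ => ?_
    rw [LinearMap.trace_tensorProduct', creg_apply, creg_apply]
  have e2 : LinearMap.mulLeft k (comul (R := k) h) =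
      βe.conj (TensorProduct.map (LinearMap.mulLeft k h) LinearMap.id) := by
    refine LinearMap.ext fun t => ?_
    obtain ⟨t, rfl⟩ := βe.surjective t
    rw [LinearEquiv.conj_apply_apply, LinearEquiv.symm_apply_apply]
    change _ * β t = β _
    induction t with
    | zero => simp
    | add a b ha hb => simp only [map_add, mul_add, ha, hb]
    | tmul x y => simp only [hβ, TensorProduct.map_tmul, LinearMap.mulLeft_apply, LinearMap.id_apply, Bialgebra.comul_mul, mul_assoc]
  rw [e1, e2, LinearMap.trace_conj', LinearMap.trace_tensorProduct', LinearMap.trace_id]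
  simp [creg_apply, mul_comm]

section charzero
variable [CharZero k]

lemma trace_idem {V : Type*} [AddCommGroup V] [Module k V] [FiniteDimensional k V] {P : V →ₗ[k] V} (hP : P ∘ₗ P = P) :
    LinearMap.trace k V P = (Module.finrank k (LinearMap.range P) : k) :=
  LinearMap.IsProj.trace (LinearMap.IsIdempotentElem.isProj_range P hP)

lemma trace_idem_zero {V : Type*} [AddCommGroup V] [Module k V] [FiniteDimensional k V] {P : V →ₗ[k] V} (hP : P ∘ₗ P = P)
    (h : LinearMap.trace k V P = 0) : P = 0 := by
  rw [trace_idem hP, Nat.cast_eq_zero] at h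
  exact LinearMap.range_eq_bot.1 (Submodule.finrank_eq_zero.1 h)

lemma inv_eq_one_of {V : Type*} [AddCommGroup V] [Module k V] [FiniteDimensional k V]
    (P T : Module.End k V) (hPP : P * P = P) (hTT : T * T = 1) (hPT : P * T = T * P)
    (key : (Module.finrank k V : k) * LinearMap.trace k V (P * T) = LinearMap.trace k V T)
    (htr : LinearMap.trace k V T ≠ 0) (v : V) (hv : v ≠ 0) (hTv : T v = v) : T = 1 := by
  set D : ℕ := Module.finrank k V
  set tr := LinearMap.trace k V
  have h2 : (2 : k) ≠ 0 := two_ne_zero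
  set E1 : Module.End k V := (2⁻¹ : k) • (1 + T) with hE1
  set E2 : Module.End k V := (2⁻¹ : k) • (1 - T) with hE2
  have hc : (2⁻¹ * 2⁻¹ : k) * 2 = 2⁻¹ := by field_simp
  have i1 : E1 * E1 = E1 := by
    rw [hE1, smul_mul_smul_comm]
    have : (1 + T) * (1 + T) = (2 : k) • (1 + T) := by
      rw [mul_add, add_mul, add_mul, hTT, two_smul]; simp; abel
    rw [this, smul_smul, hc]
  have i2 : E2 * E2 = E2 := by
    rw [hE2, smul_mul_smul_comm]
    have : (1 - T) * (1 - T) = (2 : k) • (1 - T) := by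
      rw [mul_sub, sub_mul, sub_mul, hTT, two_smul]; simp; abel
    rw [this, smul_smul, hc]
  have c1 : P * E1 = E1 * P := by
    rw [hE1, mul_smul_comm, smul_mul_assoc, mul_add, add_mul, hPT]; simp
  have c2 : P * E2 = E2 * P := by
    rw [hE2, mul_smul_comm, smul_mul_assoc, mul_sub, sub_mul, hPT]; simp
  have i3 : (P * E1) * (P * E1) = P * E1 := by
    rw [mul_assoc, ← mul_assoc E1, ← c1, mul_assoc P E1 E1, i1, ← mul_assoc, hPP]
  have i4 : (P * E2) * (P * E2) = P * E2 := by
    rw [mul_assoc, ← mul_assoc E2, ← c2, mul_assoc P E2 E2, i2, ← mul_assoc, hPP]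
  have s1 : E1 + E2 = 1 := by
    ext x
    simp only [hE1, hE2, LinearMap.add_apply, LinearMap.sub_apply, LinearMap.smul_apply, Module.End.one_apply]
    match_scalars <;> field_simp <;> ring
  have s2 : E1 - E2 = T := by
    ext x
    simp only [hE1, hE2, LinearMap.add_apply, LinearMap.sub_apply, LinearMap.smul_apply, Module.End.one_apply]
    match_scalars <;> field_simp <;> ring
  have t1 := trace_idem (P := E1) i1
  have t2 := trace_idem (P := E2) i2
  have t3 := trace_idem (P := P * E1) i3
  have t4 := trace_idem (P := P * E2) i4
  set r1 := Module.finrank k (LinearMap.range E1)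
  set r2 := Module.finrank k (LinearMap.range E2)
  set r3 := Module.finrank k (LinearMap.range (P * E1))
  set r4 := Module.finrank k (LinearMap.range (P * E2))
  have hsum : r1 + r2 = D := by
    have : tr (E1 + E2) = tr 1 := by rw [s1]
    rw [map_add] at this
    change tr E1 = _ at t1
    change tr E2 = _ at t2
    rw [t1, t2] at this
    have h3 : tr 1 = (D : k) := LinearMap.trace_one k V
    rw [h3] at this
    exact_mod_cast this
  have hdiff : (D : ℤ) * ((r3 : ℤ) - r4) = (r1 : ℤ) - r2 := by
    have e1 : tr T = tr E1 - tr E2 := by rw [← map_sub, s2]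
    have e2 : tr (P * T) = tr (P * E1) - tr (P * E2) := by rw [← map_sub, ← mul_sub, s2]
    rw [e1, e2] at key
    change tr E1 = _ at t1
    change tr E2 = _ at t2
    change tr (P * E1) = _ at t3
    change tr (P * E2) = _ at t4
    rw [t1, t2, t3, t4] at key
    exact_mod_cast key
  have hne : (r1 : ℤ) - r2 ≠ 0 := by
    intro h
    apply htr
    have e1 : tr T = tr E1 - tr E2 := by rw [← map_sub, s2]
    rw [e1]
    change tr E1 = _ at t1
    change tr E2 = _ at t2
    rw [t1, t2]
    exact_mod_cast congrArg (Int.cast : ℤ → k) h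
  have hr1 : r1 ≠ 0 := by
    intro h
    have : E1 = 0 := LinearMap.range_eq_bot.1 (Submodule.finrank_eq_zero.1 h)
    have h1 : E1 v = v := by
      simp [hE1, hTv, ← two_smul k, smul_smul]
    rw [this] at h1
    exact hv h1.symm
  have hr2 : r2 = 0 := by
    have hm : (r3 : ℤ) - r4 ≠ 0 := by
      intro h; rw [h, mul_zero] at hdiff; exact hne hdiff.symm
    have habs : |(D : ℤ)| ≤ |(r1 : ℤ) - r2| := by
      rw [← hdiff, abs_mul]
      exact le_mul_of_one_le_right (abs_nonneg _) (Int.one_le_abs hm)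
    rcases abs_cases ((r1 : ℤ) - r2) with h | h <;> rw [abs_of_nonneg (by positivity : (0 : ℤ) ≤ D)] at habs <;> omega
  have hE20 : E2 = 0 := LinearMap.range_eq_bot.1 (Submodule.finrank_eq_zero.1 hr2)
  rw [hE20, add_zero] at s1
  rw [hE20, sub_zero, s1] at s2
  exact s2.symm


include hL hl in
lemma SS_eq_id : (antipode k ∘ₗ antipode k : H →ₗ[k] H) = LinearMap.id := by
  have hnt : Nontrivial H := ⟨⟨1, 0, fun h => by
    have := congrArg lam h
    simp [hl.one] at this⟩⟩
  set T : Module.End k H := antipode k ∘ₗ antipode k with hT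
  have hTT : T * T = 1 := by
    ext y; exact S_four hL hl y
  set D : ℕ := Module.finrank k H with hD
  have hD0 : (D : k) ≠ 0 := by
    rw [Nat.cast_ne_zero]; exact Module.finrank_pos.ne'
  -- the automorphism
  let φ : H ≃ₐ[k] H := AlgEquiv.ofLinearEquiv
    (LinearEquiv.ofLinearMap T T (by exact hTT) (by exact hTT)) (by simp [hT])
    (by intro x y; simp [hT, antipode_mul_antidistrib])
  have hφ : creg k H ∘ₗ T = creg k H := by
    ext x; exact creg_autom φ x
  set P : Module.End k H := (D : k)⁻¹ • U (creg k H) with hP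
  have hPP : P * P = P := by
    have := U_comp (creg k H) (creg k H)
    have h2 : U (creg k H) * U (creg k H) = (D : k) • U (creg k H) := by
      rw [Module.End.mul_eq_comp, this, creg_sq]
      ext x; simp [U_apply, sr, TensorProduct.map_smul_right, hD]
    rw [hP, smul_mul_smul_comm, h2, smul_smul, mul_assoc, inv_mul_cancel₀ hD0, mul_one]
  have hPT : P * T = T * P := by
    rw [hP, smul_mul_assoc, mul_smul_comm]
    congr 1
    rw [Module.End.mul_eq_comp, Module.End.mul_eq_comp, comp_U, U, hT, cv_comp_SS, ← hT,
      LinearMap.comp_assoc, hφ, LinearMap.id_comp]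
  have key : (D : k) * LinearMap.trace k H (P * T) = LinearMap.trace k H T := by
    rw [hP, smul_mul_assoc, map_smul, smul_eq_mul, ← mul_assoc, mul_inv_cancel₀ hD0, one_mul]
    have := trace_USS' hL hl (creg k H)
    rw [creg_L' hL, one_mul] at this
    exact this
  have htr : LinearMap.trace k H T ≠ 0 := fun h => by
    have := trace_SS hL hl
    rw [← hT] at this
    change _ * LinearMap.trace k H T = 1 at this
    simp [h] at this
  exact inv_eq_one_of P T hPP hTT hPT key htr 1 one_ne_zero (by simp [hT])

include hL hl in
lemma SS (x : H) : antipode k (antipode k x) = x := LinearMap.congr_fun (SS_eq_id hL hl) x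

include hL hl in
lemma creg_inv (f : H →ₗ[k] k) : cv f (creg k H) = f 1 • creg k H := by
  have hnt : Nontrivial H := ⟨⟨1, 0, fun h => by
    have := congrArg lam h
    simp [hl.one] at this⟩⟩
  have hD0 : (Module.finrank k H : k) ≠ 0 := by
    rw [Nat.cast_ne_zero]; exact Module.finrank_pos.ne'
  set D : k := (Module.finrank k H : k) with hD
  set P : Module.End k H := D⁻¹ • U (creg k H) with hP
  have hPP : P * P = P := by
    have := U_comp (creg k H) (creg k H)
    have h2 : U (creg k H) * U (creg k H) = D • U (creg k H) := by
      rw [Module.End.mul_eq_comp, this, creg_sq]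
      ext x; simp [U_apply, sr, TensorProduct.map_smul_right, hD]
    rw [hP, smul_mul_smul_comm, h2, smul_smul, mul_assoc, inv_mul_cancel₀ hD0, mul_one]
  have htrace := trace_USS' hL hl (creg k H)
  rw [SS_eq_id hL hl, LinearMap.comp_id, LinearMap.trace_id, creg_L' hL, one_mul] at htrace
  have htP : LinearMap.trace k H P = 1 := by
    rw [hP, map_smul, htrace, smul_eq_mul, inv_mul_cancel₀ hD0]
  have hfr : Module.finrank k (LinearMap.range P) = 1 := by
    have h2 := trace_idem (P := P) hPP
    rw [htP] at h2
    exact_mod_cast h2.symm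
  have hP1 : P 1 = 1 := by
    rw [hP, LinearMap.smul_apply, U, cv_one_apply]
    simp only [LinearMap.id_apply, one_mul, LinearMap.comp_apply, creg_one, Algebra.linearMap_apply]
    rw [Algebra.algebraMap_eq_smul_one, smul_smul, ← hD, inv_mul_cancel₀ hD0, one_smul]
  have hsc : ∀ x, ∃ c : k, P x = c • (1 : H) := by
    intro x
    obtain ⟨c, hc⟩ := (finrank_eq_one_iff_of_nonzero' (⟨1, 1, hP1⟩ : LinearMap.range P)
      (fun h => one_ne_zero (congrArg Subtype.val h))).1 hfr ⟨P x, x, rfl⟩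
    exact ⟨c, (congrArg Subtype.val hc).symm⟩
  have hU : ∀ x, U (creg k H) x = creg k H x • (1 : H) := by
    intro x
    obtain ⟨c, hc⟩ := hsc x
    have h3 : U (creg k H) x = (D * c) • (1 : H) := by
      rw [mul_smul, ← hc, hP, LinearMap.smul_apply, smul_smul, mul_inv_cancel₀ hD0, one_smul]
    have h4 : counit (R := k) (U (creg k H) x) = creg k H x := by
      rw [U_apply, f_sr]
      exact LinearMap.congr_fun (cu_cv (creg k H)) x
    rw [h3] at h4
    rw [h3, ← h4]
    simp
  ext x
  rw [← f_sr, ← U_apply, hU]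
  simp [mul_comm]

include hL hl in
lemma creg_eq : creg k H = (Module.finrank k H : k) • lam := by
  have h1 := creg_inv hL hl lam
  rw [hl.inv, hl.one, one_smul, creg_one] at h1
  exact h1.symm

include hL hl in
lemma eq_iii (x : H) : sl (creg k H) (comul (R := k) L * (x ⊗ₜ 1)) = antipode k x := by
  have hh := creg_eq hL hl
  have h1 := eq_i hL hl x
  have h2 : (Module.finrank k H : k) * lam L = 1 := by
    have := LinearMap.congr_fun hh L
    rw [creg_L' hL] at this
    exact this.symm
  have h3 : ∀ t, sl (creg k H) t = (Module.finrank k H : k) • sl lam t := by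
    intro t
    induction t with
    | zero => simp
    | add a b ha hb => simp only [map_add, smul_add, ha, hb]
    | tmul a b => rw [hh]; simp [mul_smul]
  rw [h3, h1, smul_smul, h2, one_smul]

end charzero
end frob
end FH

end PartB

section PartC
open scoped TensorProduct
open WithConv Coalgebra HopfAlgebra

namespace FH

section rmatrix
variable {k : Type*} [Field k] {H : Type*} [Ring H] [HopfAlgebra k H]

/-- explicit R-matrix -/
structure IsR (k : Type*) [Field k] {H : Type*} [Ring H] [HopfAlgebra k H]
    {ι : Type} [Fintype ι] (a b : ι → H) : Prop where
  unit : IsUnit (∑ s, a s ⊗ₜ[k] b s)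
  q2 : ∑ s, comul (R := k) (a s) ⊗ₜ[k] b s = ∑ s, ∑ t, (a s ⊗ₜ[k] a t) ⊗ₜ[k] (b s * b t)
  q3 : ∑ s, a s ⊗ₜ[k] comul (R := k) (b s) = ∑ s, ∑ t, (a s * a t) ⊗ₜ[k] (b t ⊗ₜ[k] b s)
  e1 : ∑ s, counit (R := k) (a s) • b s = 1
  e2 : ∑ s, counit (R := k) (b s) • a s = 1
  q4 : ∀ h : H, TensorProduct.comm k H H (comul h) * (∑ s, a s ⊗ₜ[k] b s) =
    (∑ s, a s ⊗ₜ[k] b s) * comul h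

lemma exists_isR {R : H ⊗[k] H} (hR : IsRMatrixFor (Coalgebra.comul : H →ₗ[k] H ⊗[k] H) R) :
    ∃ (n : ℕ) (a b : Fin n → H), R = ∑ s, a s ⊗ₜ[k] b s ∧ IsR k a b := by
  obtain ⟨S, hS⟩ := TensorProduct.exists_finset R
  let e := S.equivFin.symm
  refine ⟨S.card, fun s => (e s).1.1, fun s => (e s).1.2, ?_⟩
  have hRR : R = ∑ s, (e s).1.1 ⊗ₜ[k] (e s).1.2 := by
    rw [hS, ← Finset.sum_coe_sort, ← e.sum_comp]
  refine ⟨hRR, ?_⟩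
  set a := fun s => (e s).1.1
  set b := fun s => (e s).1.2
  change R = ∑ s, a s ⊗ₜ[k] b s at hRR
  obtain ⟨h1, h2, h3, h4, h5, h6⟩ := hR
  refine ⟨hRR ▸ h1, ?_, ?_, ?_, ?_, hRR ▸ h6⟩
  · rw [hRR] at h2
    simpa [deltaRight, leg13, leg23, Finset.sum_mul_sum] using h2
  · rw [hRR] at h3
    have := congrArg (TensorProduct.assoc k H H H) h3
    simpa [deltaLeft, leg13, leg12, Finset.sum_mul_sum] using this
  · rw [hRR] at h4
    simpa [epsId] using h4
  · rw [hRR] at h5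
    simpa [idEps] using h5

variable {ι : Type} [Fintype ι] {a b : ι → H} (hR : IsR k a b)
variable {V : Type*} [AddCommGroup V] [Module k V]

include hR in
lemma q2' (F : H ⊗[k] H →ₗ[k] H →ₗ[k] V) :
    ∑ s, F (comul (a s)) (b s) = ∑ s, ∑ t, F (a s ⊗ₜ a t) (b s * b t) := by
  have := congrArg (TensorProduct.lift F) hR.q2
  simpa using this

include hR in
lemma q3' (F : H →ₗ[k] H ⊗[k] H →ₗ[k] V) :
    ∑ s, F (a s) (comul (b s)) = ∑ s, ∑ t, F (a s * a t) (b t ⊗ₜ b s) := by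
  have := congrArg (TensorProduct.lift F) hR.q3
  simpa using this

/-- `∑ f(a) b` -/
noncomputable def ell (a b : ι → H) (f : H →ₗ[k] k) : H := ∑ s, f (a s) • b s

/-- Drinfeld map -/
noncomputable def Phi (a b : ι → H) (f : H →ₗ[k] k) : H := ∑ s, ∑ t, f (b s * a t) • (a s * b t)

lemma Phi_eq (f : H →ₗ[k] k) : Phi a b f =
    sl f (TensorProduct.comm k H H (∑ s, a s ⊗ₜ[k] b s) * ∑ s, a s ⊗ₜ[k] b s) := by
  simp [Phi, Finset.sum_mul_sum]

lemma Phi_add (f g : H →ₗ[k] k) : Phi a b (f + g) = Phi a b f + Phi a b g := by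
  simp [Phi, add_smul, Finset.sum_add_distrib]

lemma Phi_smul (c : k) (f : H →ₗ[k] k) : Phi a b (c • f) = c • Phi a b f := by
  simp [Phi, Finset.smul_sum, mul_smul]

/-- Drinfeld map as a linear map -/
noncomputable def PhiL (k : Type*) [Field k] {H : Type*} [Ring H] [HopfAlgebra k H]
    {ι : Type} [Fintype ι] (a b : ι → H) : Module.Dual k H →ₗ[k] H where
  toFun := Phi a b
  map_add' := Phi_add
  map_smul' := Phi_smul

lemma Phi_sum {J : Type*} (s : Finset J) (f : J → H →ₗ[k] k) :
    Phi a b (∑ j ∈ s, f j) = ∑ j ∈ s, Phi a b (f j) := map_sum (PhiL k a b) f s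

/-- `(f⊗g)` as a functional -/
noncomputable def ft (f g : H →ₗ[k] k) : H ⊗[k] H →ₗ[k] k := LinearMap.mul' k k ∘ₗ TensorProduct.map f g

@[simp] lemma ft_tmul (f g : H →ₗ[k] k) (x y : H) : ft f g (x ⊗ₜ y) = f x * g y := by simp [ft]
lemma ft_comul (f g : H →ₗ[k] k) (x : H) : ft f g (comul x) = cv f g x := rfl

include hR in
lemma ell_cv (f g : H →ₗ[k] k) : ell a b (cv f g) = ell a b f * ell a b g := by
  have := q2' hR (V := H) (LinearMap.mk₂ k (fun X y => ft f g X • y) (by intros; simp [add_smul])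
    (by intros; simp [mul_smul]) (by intros; simp) (by intros; rw [smul_comm]))
  simp only [LinearMap.mk₂_apply, ft_comul, ft_tmul] at this
  rw [ell, this, ell, ell, Finset.sum_mul_sum]
  simp [smul_smul, mul_comm]

include hR in
lemma Phi_cv' (f g : H →ₗ[k] k) : Phi a b (cv f g) = ∑ s, ∑ t, g (b s * a t) • (a s * Phi a b f * b t) := by
  have h1 : ∀ t, ∑ s, cv f g (b s * a t) • (a s * b t) =
      ∑ s, ∑ s', ft f g ((b s' ⊗ₜ b s) * comul (a t)) • (a s * a s' * b t) := by
    intro t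
    have := q3' hR (V := H) (LinearMap.mk₂ k (fun x Y => ft f g (Y * comul (a t)) • (x * b t))
      (by intros; simp [add_mul]) (by intros; simp only [mul_smul_comm, smul_mul_assoc]; rw [smul_comm])
      (by intros; simp [add_mul, add_smul]) (by intros; simp [mul_smul]))
    simp only [LinearMap.mk₂_apply, ← Bialgebra.comul_mul, ft_comul] at this
    exact this
  have h2 : ∀ s s', ∑ t, ft f g ((b s' ⊗ₜ b s) * comul (a t)) • (a s * a s' * b t) =
      ∑ t, ∑ t', (f (b s' * a t) * g (b s * a t')) • (a s * a s' * (b t * b t')) := by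
    intro s s'
    have := q2' hR (V := H) (LinearMap.mk₂ k (fun X y => ft f g ((b s' ⊗ₜ b s) * X) • (a s * a s' * y))
      (by intros; simp [mul_add, add_smul]) (by intros; simp [mul_smul])
      (by intros; simp [mul_add]) (by intros; simp only [mul_smul_comm, smul_mul_assoc]; rw [smul_comm]))
    simp only [LinearMap.mk₂_apply, Algebra.TensorProduct.tmul_mul_tmul, ft_tmul] at this
    exact this
  rw [Phi, Finset.sum_comm]
  simp only [h1]
  rw [Finset.sum_comm]
  refine Finset.sum_congr rfl fun s _ => ?_
  rw [Finset.sum_comm]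
  simp only [h2]
  have h3 : ∀ t', g (b s * a t') • (a s * Phi a b f * b t') = ∑ s', ∑ t,
      (f (b s' * a t) * g (b s * a t')) • (a s * a s' * (b t * b t')) := by
    intro t'
    rw [Phi, Finset.mul_sum, Finset.sum_mul, Finset.smul_sum]
    refine Finset.sum_congr rfl fun s' _ => ?_
    rw [Finset.mul_sum, Finset.sum_mul, Finset.smul_sum]
    refine Finset.sum_congr rfl fun t _ => ?_
    rw [mul_smul_comm, smul_mul_assoc, smul_smul, mul_comm (g _)]
    simp only [mul_assoc]
  simp only [h3]
  conv_rhs => rw [Finset.sum_comm]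
  refine Finset.sum_congr rfl fun s' _ => ?_
  rw [Finset.sum_comm]

include hR in
lemma Phi_cv {f : H →ₗ[k] k} (hf : ∀ x, Phi a b f * x = x * Phi a b f) (g : H →ₗ[k] k) :
    Phi a b (cv f g) = Phi a b f * Phi a b g := by
  rw [Phi_cv' hR]
  change _ = Phi a b f * (∑ s, ∑ t, g (b s * a t) • (a s * b t))
  simp only [Finset.mul_sum, mul_smul_comm]
  refine Finset.sum_congr rfl fun s _ => Finset.sum_congr rfl fun t _ => ?_
  rw [← hf, mul_assoc]

include hR in
lemma Phi_counit : Phi a b (counit : H →ₗ[k] k) = 1 := by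
  have : Phi a b (counit : H →ₗ[k] k) = (∑ s, counit (R := k) (b s) • a s) * (∑ s, counit (R := k) (a s) • b s) := by
    rw [Finset.sum_mul_sum, Phi]; simp [smul_smul, mul_comm]
  rw [this, hR.e1, hR.e2, one_mul]

include hR in
lemma counit_Phi (f : H →ₗ[k] k) : counit (R := k) (Phi a b f) = f 1 := by
  have : f ((∑ s, counit (R := k) (a s) • b s) * (∑ s, counit (R := k) (b s) • a s)) = f 1 := by
    rw [hR.e1, hR.e2, one_mul]
  rw [← this, Finset.sum_mul_sum, Phi]; simp [mul_comm, mul_left_comm]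

/-- existence of the cointegral -/
lemma exists_coint (hR : IsR k a b) (hb : Function.Bijective (Phi (k := k) a b)) {L : H} (hL : IsInt k L) :
    ∃ lam : H →ₗ[k] k, IsCoint lam ∧ Phi a b lam = L := by
  obtain ⟨lam, hlam⟩ := hb.2 L
  refine ⟨lam, ⟨?_, fun g => ?_⟩, hlam⟩
  · rw [← counit_Phi hR, hlam, hL.one]
  · apply hb.1
    rw [Phi_cv hR _ g, hlam, hL.right, counit_Phi hR, Phi_smul, hlam]
    intro x
    rw [hlam, hL.left, hL.right]

end rmatrix
end FH

end PartC

section PartC2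
open scoped TensorProduct
open WithConv Coalgebra HopfAlgebra

namespace FH

section rmatrix2
variable {k : Type*} [Field k] {H : Type*} [Ring H] [HopfAlgebra k H]
variable {ι : Type} [Fintype ι] {a b : ι → H} (hR : IsR k a b)

lemma mulS_comul (x : H) : LinearMap.mul' k H (TensorProduct.map (antipode k) LinearMap.id (comul (R := k) x))
    = algebraMap k H (counit x) := LinearMap.congr_fun (cv_S_id (k := k) (H := H)) x

lemma mul_S_comul (x : H) : LinearMap.mul' k H (TensorProduct.map LinearMap.id (antipode k) (comul (R := k) x))
    = algebraMap k H (counit x) := LinearMap.congr_fun (cv_id_S (k := k) (H := H)) x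

include hR in
/-- `R⁻¹ = (S⊗1)R` -/
lemma SR_R : (∑ s, antipode k (a s) ⊗ₜ[k] b s) * (∑ s, a s ⊗ₜ[k] b s) = 1 := by
  have := q2' hR (V := H ⊗[k] H) ((TensorProduct.mk k H H) ∘ₗ (LinearMap.mul' k H) ∘ₗ
      TensorProduct.map (antipode k) LinearMap.id)
  simp only [LinearMap.comp_apply, LinearMap.compl₂_apply, TensorProduct.mk_apply, mulS_comul, TensorProduct.map_tmul, LinearMap.mul'_apply,
    LinearMap.id_apply] at this
  rw [Finset.sum_mul_sum]
  simp only [Algebra.TensorProduct.tmul_mul_tmul]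
  rw [← this]
  simp only [Algebra.algebraMap_eq_smul_one, TensorProduct.smul_tmul]
  rw [← TensorProduct.tmul_sum, hR.e1]; rfl

include hR in
lemma R_SR : (∑ s, a s ⊗ₜ[k] b s) * (∑ s, antipode k (a s) ⊗ₜ[k] b s) = 1 := by
  obtain ⟨v, hv⟩ := hR.unit
  have h := SR_R hR
  rw [← hv] at h ⊢
  have h' : (∑ s, antipode k (a s) ⊗ₜ[k] b s) = ((v⁻¹ : (H ⊗[k] H)ˣ) : H ⊗[k] H) := by
    rw [← one_mul ((v⁻¹ : (H ⊗[k] H)ˣ) : H ⊗[k] H), ← h, mul_assoc, Units.mul_inv, mul_one]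
  rw [h', Units.mul_inv]

include hR in
lemma q3S1 : ∑ s, ∑ t, (a s * a t) ⊗ₜ[k] (antipode k (b t) * b s) = 1 := by
  have := q3' hR (V := H ⊗[k] H) ((TensorProduct.mk k H H).compl₂ ((LinearMap.mul' k H) ∘ₗ
      TensorProduct.map (antipode k) LinearMap.id))
  simp only [LinearMap.comp_apply, LinearMap.compl₂_apply, TensorProduct.mk_apply, mulS_comul, TensorProduct.map_tmul, LinearMap.mul'_apply,
    LinearMap.id_apply] at this
  rw [← this]
  simp only [Algebra.algebraMap_eq_smul_one, TensorProduct.tmul_smul, TensorProduct.smul_tmul']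
  rw [← TensorProduct.sum_tmul, hR.e2]; rfl

include hR in
lemma q3S2 : ∑ s, ∑ t, (a s * a t) ⊗ₜ[k] (b t * antipode k (b s)) = 1 := by
  have := q3' hR (V := H ⊗[k] H) ((TensorProduct.mk k H H).compl₂ ((LinearMap.mul' k H) ∘ₗ
      TensorProduct.map LinearMap.id (antipode k)))
  simp only [LinearMap.comp_apply, LinearMap.compl₂_apply, TensorProduct.mk_apply, mul_S_comul, TensorProduct.map_tmul, LinearMap.mul'_apply,
    LinearMap.id_apply] at this
  rw [← this]
  simp only [Algebra.algebraMap_eq_smul_one, TensorProduct.tmul_smul, TensorProduct.smul_tmul']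
  rw [← TensorProduct.sum_tmul, hR.e2]; rfl

include hR in
lemma SSR : ∑ s, antipode k (a s) ⊗ₜ[k] antipode k (b s) = ∑ s, a s ⊗ₜ[k] b s := by
  let o : H ≃ₗ[k] Hᵐᵒᵖ := MulOpposite.opLinearEquiv k
  let f : H ⊗[k] H →ₗ[k] H ⊗[k] Hᵐᵒᵖ := TensorProduct.map LinearMap.id o.toLinearMap
  let g : H ⊗[k] Hᵐᵒᵖ →ₗ[k] H ⊗[k] H := TensorProduct.map LinearMap.id o.symm.toLinearMap
  have gf : ∀ x, g (f x) = x := by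
    intro x
    induction x with
    | zero => simp
    | add x y hx hy => rw [map_add, map_add, hx, hy]
    | tmul x y => simp [f, g]
  have hf : ∀ x y, f (x ⊗ₜ y) = x ⊗ₜ MulOpposite.op y := fun x y => by simp [f, o]
  have f1 : f 1 = 1 := hf 1 1
  have h1 : f (∑ s, a s ⊗ₜ[k] b s) * f (∑ s, a s ⊗ₜ[k] antipode k (b s)) = 1 := by
    rw [← f1, ← q3S1 hR]
    simp only [map_sum, hf, Finset.sum_mul_sum, Algebra.TensorProduct.tmul_mul_tmul, MulOpposite.op_mul]
  have h2 : f (∑ s, a s ⊗ₜ[k] antipode k (b s)) *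
      f (∑ s, antipode k (a s) ⊗ₜ[k] antipode k (b s)) = 1 := by
    have := congrArg (TensorProduct.map LinearMap.id (antipode k)) (R_SR hR)
    rw [Finset.sum_mul_sum] at this
    rw [← f1]
    have h1 : (1 : H ⊗[k] H) = TensorProduct.map LinearMap.id (antipode k) (1 : H ⊗[k] H) := by
      simp [Algebra.TensorProduct.one_def]
    rw [h1, ← this]
    simp only [map_sum, hf, Finset.sum_mul_sum, Algebra.TensorProduct.tmul_mul_tmul,
      TensorProduct.map_tmul, LinearMap.id_apply, antipode_mul_antidistrib, MulOpposite.op_mul]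
  have h3 := left_inv_eq_right_inv h1 h2
  rw [← gf (∑ s, a s ⊗ₜ[k] b s), h3, gf]

lemma sl_i1_mul {f : H →ₗ[k] k} (hf : ∀ x y, f (x * y) = f (y * x)) (x : H) (t : H ⊗[k] H) :
    sl f ((x ⊗ₜ 1) * t) = sl f (t * (x ⊗ₜ 1)) := by
  induction t with
  | zero => simp
  | add x y hx hy => rw [mul_add, add_mul, map_add, map_add, hx, hy]
  | tmul y z => simp [hf x y]

lemma comm_mul (x y : H ⊗[k] H) : TensorProduct.comm k H H (x * y) =
    TensorProduct.comm k H H x * TensorProduct.comm k H H y :=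
  map_mul (Algebra.TensorProduct.comm k H H) x y

/-- `Q` -/
noncomputable def Qm (k : Type*) [Field k] {H : Type*} [Ring H] [HopfAlgebra k H]
    {ι : Type} [Fintype ι] (a b : ι → H) : H ⊗[k] H :=
  TensorProduct.comm k H H (∑ s, a s ⊗ₜ[k] b s) * ∑ s, a s ⊗ₜ[k] b s

include hR in
lemma Q_comul (h : H) : Qm k a b * comul h = comul h * Qm k a b := by
  have := congrArg (TensorProduct.comm k H H) (hR.q4 h)
  rw [comm_mul, comm_mul] at this
  have hc : TensorProduct.comm k H H (TensorProduct.comm k H H (comul (R := k) h)) = comul h := by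
    simp
  rw [hc] at this
  rw [Qm, mul_assoc, ← hR.q4, ← mul_assoc, ← this, mul_assoc]

variable (hSS : ∀ x : H, antipode k (antipode k x) = x)

include hSS in
lemma opS : cv (antipodeAlgHomOp k H).toLinearMap ((MulOpposite.opLinearEquiv k).toLinearMap) = cu k H Hᵐᵒᵖ := by
  rw [← alg_cv_S (antipodeAlgHomOp k H)]
  congr 1
  ext x
  simp [hSS]

include hSS in
/-- `Δ(h₂)(S(h₁)⊗1) = 1⊗h` -/
lemma G3 (h : H) : ∑ i ∈ (ℛ k h).index,
    comul (R := k) ((ℛ k h).right i) * (antipode k ((ℛ k h).left i) ⊗ₜ 1) = 1 ⊗ₜ h := by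
  let o : (H ⊗[k] H) ≃ₗ[k] (H ⊗[k] H)ᵐᵒᵖ := MulOpposite.opLinearEquiv k
  let oi1 : Hᵐᵒᵖ →ₐ[k] (H ⊗[k] H)ᵐᵒᵖ := AlgHom.op i1
  have e1 : o.toLinearMap ∘ₗ (dl (k := k) (H := H)).toLinearMap =
      cv (o.toLinearMap ∘ₗ i1.toLinearMap) (o.toLinearMap ∘ₗ i2.toLinearMap) := by
    ext x
    rw [cv_apply, LinearMap.comp_apply, ← dl_eq, cv_apply, map_sum]
    refine Finset.sum_congr rfl fun i _ => ?_
    simp [o, i1_apply, i2_apply, ← MulOpposite.op_mul]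
  have e2 : cv (o.toLinearMap ∘ₗ i1.toLinearMap ∘ₗ antipode k) (o.toLinearMap ∘ₗ i1.toLinearMap) =
      cu k H (H ⊗[k] H)ᵐᵒᵖ := by
    have := comp_cv oi1 (antipodeAlgHomOp k H).toLinearMap (MulOpposite.opLinearEquiv k).toLinearMap
    rw [opS hSS, comp_cu] at this
    rw [this]
    rfl
  have e3 : cv (o.toLinearMap ∘ₗ i1.toLinearMap ∘ₗ antipode k) (o.toLinearMap ∘ₗ (dl (k := k) (H := H)).toLinearMap)
      = o.toLinearMap ∘ₗ i2.toLinearMap := by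
    rw [e1, ← cv_assoc, e2, cu_cv]
  have := congrArg MulOpposite.unop (LinearMap.congr_fun e3 h)
  rw [cv_apply] at this
  simpa [o, dl_apply, i1_apply, i2_apply] using this

include hR hSS in
lemma Phi_central {f : H →ₗ[k] k} (hf : ∀ x y, f (x * y) = f (y * x)) (h : H) :
    Phi a b f * h = h * Phi a b f := by
  have e : Phi a b f = sl f (Qm k a b) := Phi_eq f
  rw [e, ← sl_mul_i2, ← sl_i2_mul]
  have h2 := LinearMap.congr_fun (G2 (k := k) (H := H)) h
  rw [cv_apply] at h2
  simp only [LinearMap.comp_apply, AlgHom.toLinearMap_apply, i1_apply, i2_apply, dl_apply] at h2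
  conv_rhs => rw [← h2]
  rw [← G3 hSS h, Finset.mul_sum, Finset.sum_mul, map_sum, map_sum]
  refine Finset.sum_congr rfl fun i _ => ?_
  rw [mul_assoc, sl_i1_mul hf, ← mul_assoc, Q_comul hR]

lemma Phi_symm {f g : H →ₗ[k] k} (hf : ∀ x y, f (x * y) = f (y * x))
    (hg : ∀ x y, g (x * y) = g (y * x)) : f (Phi a b g) = g (Phi a b f) := by
  simp only [Phi, map_sum, map_smul, smul_eq_mul]
  rw [Finset.sum_comm]
  refine Finset.sum_congr rfl fun s _ => Finset.sum_congr rfl fun t _ => ?_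
  rw [hf, hg, mul_comm]

lemma ft_mul_comm {f g : H →ₗ[k] k} (hf : ∀ x y, f (x * y) = f (y * x))
    (hg : ∀ x y, g (x * y) = g (y * x)) (X Y : H ⊗[k] H) : ft f g (X * Y) = ft f g (Y * X) := by
  induction X with
  | zero => simp
  | add x y hx hy => rw [mul_add, add_mul, map_add, map_add, hx, hy]
  | tmul x x' =>
    induction Y with
    | zero => simp
    | add x y hx hy => rw [mul_add, add_mul, map_add, map_add, hx, hy]
    | tmul y y' => simp [hf x y, hg x' y']

include hR in
lemma cv_comm {f g : H →ₗ[k] k} (hf : ∀ x y, f (x * y) = f (y * x))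
    (hg : ∀ x y, g (x * y) = g (y * x)) : cv f g = cv g f := by
  ext h
  have h1 : ft f g (TensorProduct.comm k H H (comul (R := k) h)) = cv g f h := by
    rw [cv_apply]
    conv_lhs => rw [← (ℛ k h).eq]
    simp [mul_comm]
  have h2 : comul (R := k) h = (∑ s, antipode k (a s) ⊗ₜ[k] b s) *
      (TensorProduct.comm k H H (comul h) * (∑ s, a s ⊗ₜ[k] b s)) := by
    rw [hR.q4, ← mul_assoc, SR_R hR, one_mul]
  rw [← ft_comul, h2, ft_mul_comm hf hg, mul_assoc, R_SR hR, mul_one, h1]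

include hR hSS in
/-- `χ(S Φ f) = χ(Φ(f S))` for trace functions. -/
lemma chi_S_Phi {f g : H →ₗ[k] k} (hf : ∀ x y, f (x * y) = f (y * x))
    (hg : ∀ x y, g (x * y) = g (y * x)) :
    g (antipode k (Phi a b f)) = g (Phi a b (f ∘ₗ antipode k)) := by
  have hfS : ∀ x y, (f ∘ₗ antipode k) (x * y) = (f ∘ₗ antipode k) (y * x) := by
    intro x y; simp [antipode_mul_antidistrib, hf (antipode k x)]
  rw [Phi_symm hg hfS]
  -- both are images of `∑ ∑ ` expressions in R ⊗ R
  have key : ∀ F : H →ₗ[k] H →ₗ[k] k, ∑ s, F (antipode k (a s)) (antipode k (b s)) = ∑ s, F (a s) (b s) := by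
    intro F
    have := congrArg (TensorProduct.lift F) (SSR hR)
    simpa using this
  have e1 : g (antipode k (Phi a b f)) = ∑ s, ∑ t, f (b s * a t) * g (antipode k (b t) * antipode k (a s)) := by
    simp [Phi, antipode_mul_antidistrib]
  have e2 : (f ∘ₗ antipode k) (Phi a b g) = ∑ s, ∑ t, g (b s * a t) * f (antipode k (b t) * antipode k (a s)) := by
    simp [Phi, antipode_mul_antidistrib]
  have k1 : ∀ t, ∑ s, f (b s * a t) * g (antipode k (b t) * antipode k (a s)) =
      ∑ s, f (antipode k (b s) * a t) * g (antipode k (b t) * a s) := by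
    intro t
    have := key (LinearMap.mk₂ k (fun x y => f (y * a t) * g (antipode k (b t) * antipode k x))
      (by intros; simp [mul_add]) (by intros; simp; ring) (by intros; simp [add_mul]) (by intros; simp; ring))
    simp only [LinearMap.mk₂_apply, hSS] at this
    exact this.symm
  have k2 : ∀ t, ∑ s, g (b s * a t) * f (antipode k (b t) * antipode k (a s)) =
      ∑ s, g (antipode k (b s) * a t) * f (antipode k (b t) * a s) := by
    intro t
    have := key (LinearMap.mk₂ k (fun x y => g (y * a t) * f (antipode k (b t) * antipode k x))
      (by intros; simp [mul_add]) (by intros; simp; ring) (by intros; simp [add_mul]) (by intros; simp; ring))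
    simp only [LinearMap.mk₂_apply, hSS] at this
    exact this.symm
  rw [e1, e2, Finset.sum_comm]
  conv_rhs => rw [Finset.sum_comm]
  simp only [k1, k2]
  rw [Finset.sum_comm]
  exact Finset.sum_congr rfl fun t _ => Finset.sum_congr rfl fun s _ => mul_comm _ _

end rmatrix2
end FH

end PartC2

section PartD
open scoped TensorProduct
open WithConv Coalgebra HopfAlgebra

namespace FH

set_option linter.unusedSectionVars false
section wedd
variable {k : Type*} [Field k] {H : Type*} [Ring H] [Algebra k H]
variable {m : ℕ} {d : Fin m → ℕ} [hd : ∀ i, NeZero (d i)]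
variable (e : H ≃ₐ[k] ((i : Fin m) → Matrix (Fin (d i)) (Fin (d i)) k))

/-- irreducible representations -/
noncomputable def rho (i : Fin m) : H →ₐ[k] Matrix (Fin (d i)) (Fin (d i)) k :=
  (Pi.evalAlgHom k (fun i : Fin m => Matrix (Fin (d i)) (Fin (d i)) k) i).comp e.toAlgHom

lemma rho_apply (i : Fin m) (x : H) : rho e i x = e x i := rfl

/-- irreducible characters -/
noncomputable def chi (i : Fin m) : H →ₗ[k] k :=
  (Matrix.traceLinearMap (Fin (d i)) k k) ∘ₗ (rho e i).toLinearMap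

lemma chi_apply (i : Fin m) (x : H) : chi e i x = (e x i).trace := rfl

/-- trace functions -/
def IsTr (f : H →ₗ[k] k) : Prop := ∀ x y, f (x * y) = f (y * x)

lemma chi_tr (i : Fin m) : IsTr (chi e i) := by
  intro x y
  rw [chi_apply, chi_apply, map_mul, map_mul, Pi.mul_apply, Pi.mul_apply, Matrix.trace_mul_comm]

/-- primitive idempotents -/
noncomputable def EE (i : Fin m) : H := e.symm (Pi.single i (Matrix.single 0 0 1))
/-- central idempotents -/
noncomputable def ce (i : Fin m) : H := e.symm (Pi.single i 1)

lemma EE_idem (i : Fin m) : EE e i * EE e i = EE e i := by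
  rw [EE, ← map_mul, ← Pi.single_mul, Matrix.single_mul_single_same, one_mul]

lemma chi_EE (i j : Fin m) : chi e i (EE e j) = if i = j then 1 else 0 := by
  rw [chi_apply, EE, AlgEquiv.apply_symm_apply]
  by_cases h : i = j
  · subst h; simp
  · simp [h]

lemma chi_one (i : Fin m) : chi e i 1 = d i := by
  rw [chi_apply]; simp

lemma chi_ce (i j : Fin m) (x : H) : chi e i (x * ce e j) = if i = j then chi e i x else 0 := by
  rw [chi_apply, ce, map_mul, AlgEquiv.apply_symm_apply, Pi.mul_apply, chi_apply]
  by_cases h : i = j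
  · subst h; simp
  · simp [h]

lemma chi_inj {i j : Fin m} (h : chi e i = chi e j) : i = j := by
  by_contra hne
  have := LinearMap.congr_fun h (EE e i)
  rw [chi_EE, chi_EE, if_pos rfl, if_neg (Ne.symm hne)] at this
  exact one_ne_zero this

lemma mat_tr {n : ℕ} [NeZero n] (g : Matrix (Fin n) (Fin n) k →ₗ[k] k) (hg : ∀ x y, g (x * y) = g (y * x))
    (M : Matrix (Fin n) (Fin n) k) : g M = g (Matrix.single 0 0 1) * M.trace := by
  have h1 : ∀ i j c, g (Matrix.single i j c) = if i = j then c * g (Matrix.single 0 0 1) else 0 := by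
    intro i j c
    split_ifs with h
    · subst h
      have : Matrix.single i i c = Matrix.single i 0 c * Matrix.single 0 i 1 := by simp
      rw [this, hg, Matrix.single_mul_single_same, one_mul]
      have : Matrix.single (0 : Fin n) (0 : Fin n) c = c • Matrix.single 0 0 1 := by simp
      rw [this, map_smul, smul_eq_mul]
    · have : Matrix.single i j c = Matrix.single i i 1 * Matrix.single i j c := by simp
      rw [this, hg, Matrix.single_mul_single_of_ne _ _ _ _ (Ne.symm h), map_zero]
  generalize g (Matrix.single 0 0 1) = c0 at h1 ⊢
  conv_lhs => rw [Matrix.matrix_eq_sum_single M]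
  simp only [map_sum, h1]
  rw [Matrix.trace, Finset.mul_sum]
  refine Finset.sum_congr rfl fun i _ => ?_
  rw [Finset.sum_ite_eq, if_pos (Finset.mem_univ _), mul_comm]; rfl

lemma tr_expand {f : H →ₗ[k] k} (hf : IsTr f) : f = ∑ l, f (EE e l) • chi e l := by
  ext x
  have hx : x = ∑ l, e.symm (Pi.single l (e x l)) := by
    rw [← map_sum, Finset.univ_sum_single, AlgEquiv.symm_apply_apply]
  have : ∀ l, f (e.symm (Pi.single l (e x l))) = f (EE e l) * chi e l x := by
    intro l
    let g : Matrix (Fin (d l)) (Fin (d l)) k →ₗ[k] k :=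
      f ∘ₗ e.symm.toLinearMap ∘ₗ LinearMap.single k (fun i : Fin m => Matrix (Fin (d i)) (Fin (d i)) k) l
    have hg : ∀ x y, g (x * y) = g (y * x) := by
      intro x y
      have h1 : ∀ z w, g (z * w) = f (e.symm (Pi.single l z) * e.symm (Pi.single l w)) := by
        intro z w
        rw [← map_mul, ← Pi.single_mul]; rfl
      rw [h1, h1, hf]
    exact mat_tr g hg (e x l)
  conv_lhs => rw [hx]
  rw [map_sum]
  simp [this]

lemma creg_chi : creg k H = ∑ l, (d l : k) • chi e l := by
  ext x
  have h1 : creg k H x = LinearMap.trace k ((i : Fin m) → Matrix (Fin (d i)) (Fin (d i)) k)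
      (LinearMap.mulLeft k (e x)) := by
    change LinearMap.trace k H (LinearMap.mulLeft k x) = _
    rw [← LinearMap.trace_conj' _ e.toLinearEquiv]
    congr 1
    refine LinearMap.ext fun y => ?_
    simp [LinearEquiv.conj_apply]
  rw [h1, LinearMap.trace_eq_matrix_trace k (Pi.basis fun i : Fin m => Matrix.stdBasis k (Fin (d i)) (Fin (d i)))]
  rw [Matrix.trace, Fintype.sum_sigma]
  simp only [LinearMap.sum_apply, LinearMap.smul_apply]
  refine Finset.sum_congr rfl fun i _ => ?_
  rw [Fintype.sum_prod_type]
  have : ∀ a b : Fin (d i), (LinearMap.toMatrix (Pi.basis fun i : Fin m => Matrix.stdBasis k (Fin (d i)) (Fin (d i)))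
    (Pi.basis fun i : Fin m => Matrix.stdBasis k (Fin (d i)) (Fin (d i))) (LinearMap.mulLeft k (e x))).diag ⟨i, (a, b)⟩
     = e x i a a := by
    intro a b
    rw [Matrix.diag_apply, LinearMap.toMatrix_apply, Pi.basis_repr, Pi.basis_apply, Matrix.stdBasis_eq_single]
    simp [Matrix.stdBasis, Matrix.mul_apply, Matrix.single_apply]
  simp only [this]
  simp [chi_apply, Matrix.trace, Finset.mul_sum]

/-- scalars of central elements -/
noncomputable def ww (i : Fin m) (z : H) : k := chi e i z / d i

variable [CharZero k]

lemma d_ne (i : Fin m) : (d i : k) ≠ 0 := Nat.cast_ne_zero.2 (NeZero.ne (d i))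

lemma central_scalar {z : H} (hz : ∀ x, z * x = x * z) (i : Fin m) :
    e z i = ww e i z • (1 : Matrix (Fin (d i)) (Fin (d i)) k) := by
  have h : e z i ∈ Set.range (Matrix.scalar (Fin (d i)) : k → Matrix (Fin (d i)) (Fin (d i)) k) := by
    rw [Matrix.mem_range_scalar_iff_commute_single']
    intro a b
    have := congrArg (fun w => e w i) (hz (e.symm (Pi.single i (Matrix.single a b 1))))
    simp at this
    exact this.symm
  obtain ⟨c, hc⟩ := h
  have h1 : e z i = c • (1 : Matrix (Fin (d i)) (Fin (d i)) k) := by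
    rw [← hc]; simp [Matrix.smul_one_eq_diagonal]
  have h2 : ww e i z = c := by
    rw [ww, chi_apply, h1]
    have := d_ne (k := k) (d := d) i
    simp [this]
  rw [h1, h2]

lemma chi_central_mul {z : H} (hz : ∀ x, z * x = x * z) (i : Fin m) (x : H) :
    chi e i (z * x) = ww e i z * chi e i x := by
  rw [chi_apply, map_mul, Pi.mul_apply, central_scalar e hz]
  simp [chi_apply]

lemma ww_mul {z : H} (hz : ∀ x, z * x = x * z) (i : Fin m) (x : H) :
    ww e i (z * x) = ww e i z * ww e i x := by
  rw [ww, chi_central_mul e hz, ww, ww, mul_div_assoc]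

lemma ww_one (i : Fin m) : ww e i 1 = 1 := by
  rw [ww, chi_one, div_self (d_ne i)]

lemma ww_ext {z z' : H} (hz : ∀ x, z * x = x * z) (hz' : ∀ x, z' * x = x * z') (h : ∀ i, ww e i z = ww e i z') :
    z = z' := by
  apply e.injective
  ext1 i
  rw [central_scalar e hz, central_scalar e hz', h]

lemma chi_eq_ww (i : Fin m) (x : H) : chi e i x = d i * ww e i x := by
  have := d_ne (k := k) (d := d) i
  rw [ww]; field_simp

include e in
lemma sum_sq : Module.finrank k H = ∑ i, d i ^ 2 := by
  have := LinearMap.congr_fun (creg_chi e) 1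
  have fd : FiniteDimensional k H := FiniteDimensional.of_injective e.toLinearMap e.injective
  have h0 : creg k H 1 = (Module.finrank k H : k) := by
    change LinearMap.trace k H (LinearMap.mulLeft k 1) = _
    rw [LinearMap.mulLeft_one, LinearMap.trace_id]
  rw [h0] at this
  simp only [LinearMap.sum_apply, LinearMap.smul_apply, chi_one, smul_eq_mul] at this
  have h : ((Module.finrank k H : ℕ) : k) = ((∑ i, d i ^ 2 : ℕ) : k) := by
    rw [this]; push_cast; simp [sq]
  exact_mod_cast h

/-- characters -/
def IsChar (f : H →ₗ[k] k) : Prop :=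
  ∃ (n : Type) (_ : Fintype n) (_ : DecidableEq n) (φ : H →ₐ[k] Matrix n n k), ∀ x, f x = (φ x).trace

omit [CharZero k] in
lemma IsChar.tr {f : H →ₗ[k] k} (hf : IsChar f) : IsTr f := by
  obtain ⟨n, _, _, φ, h⟩ := hf
  intro x y
  rw [h, h, map_mul, map_mul, Matrix.trace_mul_comm]

lemma IsChar.nat {f : H →ₗ[k] k} (hf : IsChar f) (l : Fin m) : ∃ N : ℕ, f (EE e l) = N := by
  obtain ⟨n, _, _, φ, h⟩ := hf
  refine ⟨Module.finrank k (LinearMap.range (Matrix.toLin' (φ (EE e l)))), ?_⟩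
  rw [h, ← Matrix.trace_toLin'_eq]
  apply trace_idem
  rw [← Matrix.toLin'_mul, ← map_mul, EE_idem]

omit [CharZero k] in
lemma chi_char (i : Fin m) : IsChar (chi e i) := ⟨_, inferInstance, inferInstance, rho e i, fun _ => rfl⟩

omit [CharZero k] in
lemma algHom_char (γ : H →ₐ[k] k) : IsChar γ.toLinearMap := by
  refine ⟨Unit, inferInstance, inferInstance, (Algebra.ofId k (Matrix Unit Unit k)).comp γ, fun x => ?_⟩
  simp [Algebra.ofId_apply, Matrix.algebraMap_eq_diagonal]

end wedd

section weddH
variable {k : Type*} [Field k] {H : Type*} [Ring H] [HopfAlgebra k H]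

lemma IsChar.cv {f g : H →ₗ[k] k} (hf : IsChar f) (hg : IsChar g) : IsChar (cv f g) := by
  obtain ⟨n, _, _, φ, h⟩ := hf
  obtain ⟨n', _, _, φ', h'⟩ := hg
  refine ⟨n × n', inferInstance, inferInstance, (Matrix.kroneckerAlgEquiv n n' k).toAlgHom.comp
    ((Algebra.TensorProduct.map φ φ').comp dl), fun x => ?_⟩
  rw [cv_apply]
  simp only [AlgHom.comp_apply, dl_apply]
  conv_rhs => rw [← (ℛ k x).eq]
  simp [h, h', map_sum, Matrix.trace_sum, Matrix.kroneckerAlgEquiv_apply, Matrix.trace_kronecker]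

lemma IsChar.S {f : H →ₗ[k] k} (hf : IsChar f) : IsChar (f ∘ₗ antipode k) := by
  obtain ⟨n, _, _, φ, h⟩ := hf
  refine ⟨n, inferInstance, inferInstance, (Matrix.transposeAlgEquiv n k k).symm.toAlgHom.comp
    ((AlgHom.op φ).comp (antipodeAlgHomOp k H)), fun x => ?_⟩
  simp [h]

lemma IsTr.cv {f g : H →ₗ[k] k} (hf : IsTr f) (hg : IsTr g) : IsTr (cv f g) := by
  intro x y
  rw [← ft_comul, ← ft_comul, Bialgebra.comul_mul, Bialgebra.comul_mul, ft_mul_comm hf hg]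

lemma IsTr.S {f : H →ₗ[k] k} (hf : IsTr f) : IsTr (f ∘ₗ antipode k) := by
  intro x y
  simp [antipode_mul_antidistrib, hf (antipode k x)]

lemma counit_char : IsChar (counit : H →ₗ[k] k) := algHom_char (Bialgebra.counitAlgHom k H)

variable [FiniteDimensional k H] [CharZero k]
variable {m : ℕ} {d : Fin m → ℕ} [hd : ∀ i, NeZero (d i)]
variable (e : H ≃ₐ[k] ((i : Fin m) → Matrix (Fin (d i)) (Fin (d i)) k))
variable {L : H} (hL : IsInt k L) {lam : H →ₗ[k] k} (hl : IsCoint lam)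

include hL hl

lemma orth (i j : Fin m) : cv (chi e j) (chi e i ∘ₗ antipode k) L = if i = j then 1 else 0 := by
  have h1 := eq_iii hL hl (ce e j)
  have h2 : sl (creg k H) (comul (R := k) L * (ce e j ⊗ₜ 1)) = (d j : k) • sl (chi e j) (comul L) := by
    have : ∀ X : H ⊗[k] H, sl (creg k H) (X * (ce e j ⊗ₜ 1)) = (d j : k) • sl (chi e j) X := by
      intro X
      induction X with
      | zero => simp
      | add x y hx hy => rw [add_mul, map_add, map_add, hx, hy, smul_add]
      | tmul x y =>
        simp [creg_chi e, chi_ce, smul_smul]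
    exact this _
  rw [h2] at h1
  have h3 := congrArg (chi e i ∘ₗ antipode k) h1
  rw [map_smul, f_sl, LinearMap.comp_apply, SS hL hl] at h3
  have h4 : chi e i (ce e j) = if i = j then (d j : k) else 0 := by
    have := chi_ce e i j 1
    rw [one_mul, chi_one] at this
    rw [this]; split_ifs with h <;> simp [h]
  rw [h4] at h3
  have := d_ne (k := k) (d := d) j
  split_ifs at h3 ⊢ with h
  · rw [smul_eq_mul] at h3
    exact mul_left_cancel₀ this (by rw [h3, mul_one])
  · simpa [this] using h3

lemma mult {f : H →ₗ[k] k} (hf : IsTr f) (i : Fin m) : cv f (chi e i ∘ₗ antipode k) L = f (EE e i) := by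
  have hlin : ∀ g : H →ₗ[k] k, cv g (chi e i ∘ₗ antipode k) L = g (sr (chi e i ∘ₗ antipode k) (comul L)) :=
    fun g => (f_sr _ _ _).symm
  rw [hlin]
  conv_lhs => rw [tr_expand e hf]
  rw [LinearMap.sum_apply]
  simp_rw [LinearMap.smul_apply, ← hlin, orth e hL hl]
  simp
end weddH
end FH

end PartD

section PartE
open scoped TensorProduct
open WithConv Coalgebra HopfAlgebra

namespace FH
set_option linter.unusedSectionVars false

lemma dvd_of_integral {k : Type*} [Field k] [CharZero k] {D c : ℕ} (hc : c ≠ 0) {t : k}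
    (ht : IsIntegral ℤ t) (h : (D : k) = c * t) : c ∣ D := by
  have hck : (c : k) ≠ 0 := Nat.cast_ne_zero.2 hc
  have h1 : t = algebraMap ℚ k ((D : ℚ) / c) := by
    rw [map_div₀, map_natCast, map_natCast, h]; field_simp
  rw [h1, isIntegral_algebraMap_iff (algebraMap ℚ k).injective, IsIntegrallyClosed.isIntegral_iff] at ht
  obtain ⟨y, hy⟩ := ht
  have hcq : (c : ℚ) ≠ 0 := Nat.cast_ne_zero.2 hc
  have h2 : (D : ℚ) = c * y := by
    rw [eq_intCast] at hy
    rw [hy]; field_simp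
  have h3 : (c : ℤ) ∣ (D : ℤ) := ⟨y, by exact_mod_cast h2⟩
  exact_mod_cast h3

section integrality
variable {k : Type*} [Field k] [CharZero k] {H : Type*} [Ring H] [HopfAlgebra k H] [FiniteDimensional k H]
variable {m : ℕ} {d : Fin m → ℕ} [hd : ∀ i, NeZero (d i)]
variable (e : H ≃ₐ[k] ((i : Fin m) → Matrix (Fin (d i)) (Fin (d i)) k))
variable {L : H} (hL : IsInt k L) {lam : H →ₗ[k] k} (hl : IsCoint lam)
variable {ι : Type} [Fintype ι] {a b : ι → H} (hR : IsR k a b) (hP : Phi a b lam = L)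

include hL hl hR

lemma Phi_tr_central {f : H →ₗ[k] k} (hf : IsTr f) (x : H) : Phi a b f * x = x * Phi a b f :=
  Phi_central hR (SS hL hl) hf x

lemma psi_cv {f : H →ₗ[k] k} (hf : IsTr f) (g : H →ₗ[k] k) (j : Fin m) :
    ww e j (Phi a b (cv f g)) = ww e j (Phi a b f) * ww e j (Phi a b g) := by
  have hc := Phi_tr_central hL hl hR hf
  rw [Phi_cv hR hc, ww_mul e hc]

lemma psi_mem {f : H →ₗ[k] k} (hf : IsChar f) (j : Fin m) :
    ww e j (Phi a b f) ∈ Submodule.span ℤ (Set.range fun l => ww e j (Phi a b (chi e l))) := by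
  have h1 : ww e j (Phi a b f) = ∑ l, f (EE e l) * ww e j (Phi a b (chi e l)) := by
    conv_lhs => rw [tr_expand e hf.tr]
    rw [Phi_sum, ww, map_sum, Finset.sum_div]
    refine Finset.sum_congr rfl fun l _ => ?_
    rw [Phi_smul, map_smul, smul_eq_mul, mul_div_assoc]; rfl
  rw [h1]
  refine Submodule.sum_mem _ fun l _ => ?_
  obtain ⟨N, hN⟩ := hf.nat e l
  rw [hN, ← nsmul_eq_mul]
  exact Submodule.smul_of_tower_mem _ N (Submodule.subset_span ⟨l, rfl⟩)

lemma psi_int {f : H →ₗ[k] k} (hf : IsChar f) (j : Fin m) : IsIntegral ℤ (ww e j (Phi a b f)) := by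
  refine isIntegral_of_smul_mem_submodule
    (Submodule.span ℤ (Set.range fun l => ww e j (Phi a b (chi e l)))) ?_ ?_ _ ?_
  · intro h
    have := psi_mem e hL hl hR (counit_char (k := k) (H := H)) j
    rw [h, Phi_counit hR, ww_one, Submodule.mem_bot] at this
    exact one_ne_zero this
  · exact Submodule.fg_span (Set.finite_range _)
  · intro n hn
    induction hn using Submodule.span_induction with
    | mem x hx =>
      obtain ⟨l, rfl⟩ := hx
      have := psi_mem e hL hl hR (hf.cv (chi_char e l)) j
      rw [psi_cv e hL hl hR hf.tr] at this
      exact this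
    | zero => simp
    | add x y _ _ hx hy => rw [smul_add]; exact add_mem hx hy
    | smul c x _ hx => rw [smul_comm]; exact Submodule.smul_mem _ _ hx

include e hP in
lemma dim_dvd (j : Fin m) : d j ^ 2 ∣ Module.finrank k H := by
  have hc : ∀ {f : H →ₗ[k] k} (hf : IsTr f) (x : H), Phi a b f * x = x * Phi a b f :=
    fun hf => Phi_tr_central hL hl hR hf
  have ht := chi_tr e j
  have h1 : creg k H (Phi a b (chi e j) * Phi a b (chi e j ∘ₗ antipode k)) = Module.finrank k H := by
    rw [← Phi_cv hR (hc ht), Phi_symm (creg_mul_comm (k := k)) (ht.cv ht.S), creg_eq hL hl, Phi_smul, hP, map_smul,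
      orth e hL hl, if_pos rfl]
    simp
  have h2 : creg k H (Phi a b (chi e j) * Phi a b (chi e j ∘ₗ antipode k)) =
      ((d j ^ 2 : ℕ) : k) * ∑ i, ww e j (Phi a b (chi e i)) * ww e j (Phi a b (chi e i ∘ₗ antipode k)) := by
    rw [creg_chi e, Finset.mul_sum, LinearMap.sum_apply]
    refine Finset.sum_congr rfl fun i _ => ?_
    have e1 : (d i : k) * ww e i (Phi a b (chi e j)) = d j * ww e j (Phi a b (chi e i)) := by
      rw [← chi_eq_ww, ← chi_eq_ww, Phi_symm ht (chi_tr e i)]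
    have e2 : (d i : k) * ww e i (Phi a b (chi e j ∘ₗ antipode k)) = d j * ww e j (Phi a b (chi e i ∘ₗ antipode k)) := by
      rw [← chi_eq_ww, ← chi_eq_ww, ← chi_S_Phi hR (SS hL hl) (chi_tr e i) ht,
        Phi_symm (chi_tr e i) ht.S]
      rfl
    rw [LinearMap.smul_apply, chi_central_mul e (hc ht), chi_eq_ww, smul_eq_mul]
    calc _ = ((d i : k) * ww e i (Phi a b (chi e j))) * ((d i : k) * ww e i (Phi a b (chi e j ∘ₗ antipode k))) := by ring
      _ = _ := by rw [e1, e2]; push_cast; ring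
  refine dvd_of_integral (k := k) (pow_ne_zero 2 (NeZero.ne (d j))) ?_ (h1.symm.trans h2)
  exact IsIntegral.sum _ fun i _ => (psi_int e hL hl hR (chi_char e i) j).mul (psi_int e hL hl hR (chi_char e i).S j)

end integrality
end FH

end PartE

section PartF
open scoped TensorProduct
open WithConv Coalgebra HopfAlgebra

namespace FH
set_option linter.unusedSectionVars false

section chr
variable {k : Type*} [Field k] {H : Type*} [Ring H] [HopfAlgebra k H]

/-- one-dimensional representations -/
def Chr (k : Type*) [Field k] (H : Type*) [Ring H] [HopfAlgebra k H] := H →ₐ[k] k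

/-- underlying algebra map -/
def Chr.hom (γ : Chr k H) : H →ₐ[k] k := γ
/-- underlying linear map -/
def Chr.lin (γ : Chr k H) : H →ₗ[k] k := γ.hom.toLinearMap

lemma Chr.lin_inj {γ δ : Chr k H} (h : γ.lin = δ.lin) : γ = δ := AlgHom.toLinearMap_injective h
lemma Chr.lin_apply (γ : Chr k H) (x : H) : γ.lin x = γ.hom x := rfl
lemma Chr.char (γ : Chr k H) : IsChar γ.lin := algHom_char γ.hom
lemma Chr.tr (γ : Chr k H) : IsTr γ.lin := γ.char.tr

noncomputable instance : Mul (Chr k H) :=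
  ⟨fun γ δ => (Algebra.TensorProduct.lift γ.hom δ.hom (fun _ _ => Commute.all _ _)).comp dl⟩
noncomputable instance : One (Chr k H) := ⟨Bialgebra.counitAlgHom k H⟩
noncomputable instance : Inv (Chr k H) := ⟨fun γ => AlgHom.ofLinearMap (γ.lin ∘ₗ antipode k)
  (by simp [Chr.lin_apply]) (by intro x y; simp [Chr.lin_apply, antipode_mul_antidistrib, mul_comm])⟩

lemma Chr.mul_lin (γ δ : Chr k H) : (γ * δ).lin = cv γ.lin δ.lin := by
  ext x
  rw [cv_apply]
  change (Algebra.TensorProduct.lift γ.hom δ.hom (fun _ _ => Commute.all _ _)) (comul x) = _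
  conv_lhs => rw [← (ℛ k x).eq]
  rw [map_sum]
  simp [Chr.lin_apply]
lemma Chr.one_lin : (1 : Chr k H).lin = counit := rfl
lemma Chr.inv_lin (γ : Chr k H) : (γ⁻¹).lin = γ.lin ∘ₗ antipode k := rfl

lemma counit_eq_cu : (counit : H →ₗ[k] k) = cu k H k := by ext x; rw [cu_apply]; rfl

noncomputable instance : Group (Chr k H) := Group.ofLeftAxioms
  (fun a b c => Chr.lin_inj (by simp only [Chr.mul_lin, cv_assoc]))
  (fun a => Chr.lin_inj (by rw [Chr.mul_lin, Chr.one_lin, counit_eq_cu, cu_cv]))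
  (fun a => Chr.lin_inj (by rw [Chr.mul_lin, Chr.inv_lin, Chr.one_lin, counit_eq_cu]; exact alg_S_cv a.hom))
end chr

lemma trace_mul_one {k : Type*} [Field k] {n : ℕ} (hn : n = 1) (M N : Matrix (Fin n) (Fin n) k) :
    (M * N).trace = M.trace * N.trace := by
  subst hn; simp [Matrix.trace, Matrix.mul_apply]

section act
variable {k : Type*} [Field k] [CharZero k] {H : Type*} [Ring H] [HopfAlgebra k H] [FiniteDimensional k H]
variable {m : ℕ} {d : Fin m → ℕ} [hd : ∀ i, NeZero (d i)]
variable (e : H ≃ₐ[k] ((i : Fin m) → Matrix (Fin (d i)) (Fin (d i)) k))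
variable {L : H} (hL : IsInt k L) {lam : H →ₗ[k] k} (hl : IsCoint lam)
variable {ι : Type} [Fintype ι] {a b : ι → H} (hR : IsR k a b)

/-- one-dimensional irreducibles -/
noncomputable def gam (l : Fin m) (h : d l = 1) : Chr k H :=
  AlgHom.ofLinearMap (chi e l) (by rw [chi_one, h, Nat.cast_one])
    (by intro x y; rw [chi_apply, map_mul, Pi.mul_apply, trace_mul_one h]; rfl)

lemma gam_lin (l : Fin m) (h : d l = 1) : (gam e l h).lin = chi e l := rfl

include hL hl

lemma irr_of_norm {f : H →ₗ[k] k} (hf : IsChar f) (h : cv f (f ∘ₗ antipode k) L = 1) : ∃ l, f = chi e l := by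
  choose N hN using hf.nat e
  have hfS : f = ∑ l, (N l : k) • chi e l := by
    conv_lhs => rw [tr_expand e hf.tr]
    simp [hN]
  have h1 : cv f (f ∘ₗ antipode k) L = ∑ l, (N l : k) * N l := by
    have hlin : ∀ g : H →ₗ[k] k, cv f (g ∘ₗ antipode k) L = g (antipode k (sl f (comul L))) :=
      fun g => (f_sl _ _ _).symm
    rw [hlin]
    conv_lhs => enter [1]; rw [hfS]
    rw [LinearMap.sum_apply]
    simp_rw [LinearMap.smul_apply, ← hlin, mult e hL hl hf.tr, hN, smul_eq_mul]
  rw [h] at h1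
  have h2 : ∑ l, N l * N l = 1 := by exact_mod_cast h1.symm
  have h3 : ∃ l, N l ≠ 0 := by
    by_contra! hc
    simp [hc] at h2
  obtain ⟨l, hl0⟩ := h3
  have h4 : ∀ l', l' ≠ l → N l' = 0 := by
    intro l' hne
    by_contra hc
    have := Finset.add_le_sum (f := fun l => N l * N l) (s := Finset.univ) (fun _ _ => Nat.zero_le _)
      (Finset.mem_univ l) (Finset.mem_univ l') (Ne.symm hne)
    have p1 : 0 < N l * N l := by positivity
    have p2 : 0 < N l' * N l' := by positivity
    simp only [h2] at this
    omega
  rw [Finset.sum_eq_single l (fun l' _ hne => by simp [h4 l' hne]) (by simp)] at h2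
  have h5 : N l = 1 := Nat.eq_one_of_mul_eq_one_right h2
  refine ⟨l, ?_⟩
  rw [hfS, Finset.sum_eq_single l (fun l' _ hne => by simp [h4 l' hne]) (by simp), h5]
  simp

lemma chr_irr (γ : Chr k H) : ∃ l, ∃ h : d l = 1, gam e l h = γ := by
  obtain ⟨l, h⟩ := irr_of_norm e hL hl γ.char (by
    rw [← Chr.inv_lin, ← Chr.mul_lin, mul_inv_cancel, Chr.one_lin, hL.one])
  have h1 : d l = 1 := by
    have := LinearMap.congr_fun h 1
    rw [chi_one, Chr.lin_apply, map_one] at this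
    exact_mod_cast this.symm
  exact ⟨l, h1, Chr.lin_inj h.symm⟩

/-- bijection between one-dimensional irreducibles and characters -/
noncomputable def gamEquiv : {l : Fin m // d l = 1} ≃ Chr k H :=
  Equiv.ofBijective (fun l => gam e l.1 l.2) ⟨fun l l' h => Subtype.ext (chi_inj e (congrArg Chr.lin h)),
    fun γ => by obtain ⟨l, h, h'⟩ := chr_irr e hL hl γ; exact ⟨⟨l, h⟩, h'⟩⟩

include e in
lemma finite_chr : Finite (Chr k H) := Finite.of_equiv _ (gamEquiv e hL hl)

include hR

omit hL hl in
lemma chr_comm (γ δ : Chr k H) : γ * δ = δ * γ :=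
  Chr.lin_inj (by rw [Chr.mul_lin, Chr.mul_lin, cv_comm hR γ.tr δ.tr])

lemma exists_act (γ : Chr k H) (i : Fin m) : ∃ l, cv γ.lin (chi e i) = chi e l := by
  refine irr_of_norm e hL hl (γ.char.cv (chi_char e i)) ?_
  have ht := chi_tr e i
  rw [cv_comp_S, ← Chr.inv_lin, cv_assoc, cv_comm hR γ.tr (ht.cv (ht.S.cv (γ⁻¹).tr)), cv_assoc, cv_assoc,
    ← Chr.mul_lin, inv_mul_cancel, Chr.one_lin, counit_eq_cu, cv_cu, orth e hL hl, if_pos rfl]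

/-- action on irreducibles -/
noncomputable def act (γ : Chr k H) (i : Fin m) : Fin m := (exists_act e hL hl hR γ i).choose

lemma act_spec (γ : Chr k H) (i : Fin m) : cv γ.lin (chi e i) = chi e (act e hL hl hR γ i) :=
  (exists_act e hL hl hR γ i).choose_spec

lemma act_mul (γ δ : Chr k H) (i : Fin m) : act e hL hl hR (γ * δ) i = act e hL hl hR γ (act e hL hl hR δ i) :=
  chi_inj e (by rw [← act_spec, ← act_spec, ← act_spec, Chr.mul_lin, cv_assoc])

lemma act_one (i : Fin m) : act e hL hl hR 1 i = i :=
  chi_inj e (by rw [← act_spec, Chr.one_lin, counit_eq_cu, cu_cv])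

/-- the action -/
@[reducible] noncomputable def chrAction : MulAction (Chr k H) (Fin m) where
  smul := act e hL hl hR
  one_smul := act_one e hL hl hR
  mul_smul := act_mul e hL hl hR

lemma act_d (γ : Chr k H) (i : Fin m) : d (act e hL hl hR γ i) = d i := by
  have := LinearMap.congr_fun (act_spec e hL hl hR γ i) 1
  rw [cv_one_apply, chi_one, chi_one, Chr.lin_apply, map_one, one_mul] at this
  exact_mod_cast this.symm

lemma stab_dvd {q : ℕ} (hq : q.Prime) (hqd : ∀ l, d l ≠ 1 → q ∣ d l) (j : Fin m) (hj : d j ≠ 1) :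
    q ∣ Nat.card {γ : Chr k H // act e hL hl hR γ j = j} := by
  classical
  have ht := chi_tr e j
  have hch := (chi_char e j).cv (chi_char e j).S
  choose N hN using hch.nat e
  have h1 : d j * d j = ∑ l, N l * d l := by
    have := LinearMap.congr_fun (tr_expand e hch.tr) 1
    rw [cv_one_apply, LinearMap.comp_apply, antipode_one, chi_one, LinearMap.sum_apply] at this
    simp only [hN, LinearMap.smul_apply, chi_one, smul_eq_mul] at this
    exact_mod_cast this
  have h2 : ∀ l (h : d l = 1), N l = if act e hL hl hR (gam e l h) j = j then 1 else 0 := by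
    intro l h
    have : (N l : k) = if act e hL hl hR (gam e l h) j = j then 1 else 0 := by
      rw [← hN, ← mult e hL hl hch.tr, cv_assoc, ← gam_lin e l h, ← cv_comp_S, act_spec e hL hl hR, orth e hL hl]
    split_ifs at this ⊢
    · exact_mod_cast this
    · exact_mod_cast this
  have h3 : ∑ l, N l * d l = ∑ l with d l = 1, N l + ∑ l with ¬ d l = 1, N l * d l := by
    rw [← Finset.sum_filter_add_sum_filter_not Finset.univ (fun l => d l = 1)]
    congr 1
    refine Finset.sum_congr rfl fun l hl => ?_
    rw [(Finset.mem_filter.1 hl).2, mul_one]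
  have h4 : q ∣ ∑ l with ¬ d l = 1, N l * d l :=
    Finset.dvd_sum fun l hl => (hqd l (Finset.mem_filter.1 hl).2).mul_left _
  have h5 : q ∣ ∑ l with d l = 1, N l := by
    rw [← Nat.dvd_add_left h4, ← h3, ← h1]
    exact (hqd j hj).mul_left _
  have h6 : ∑ l with d l = 1, N l = Nat.card {γ : Chr k H // act e hL hl hR γ j = j} := by
    have fin := finite_chr e hL hl
    letI := Fintype.ofFinite (Chr k H)
    rw [Finset.sum_subtype (p := fun l => d l = 1) _ (by simp), Nat.card_eq_fintype_card, Fintype.card_subtype,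
      Finset.card_filter, ← (gamEquiv e hL hl).sum_comp]
    exact Finset.sum_congr rfl fun l _ => h2 l.1 l.2
  rwa [h6] at h5

lemma stab_order {q : ℕ} (hq : q.Prime) (hqd : ∀ l, d l ≠ 1 → q ∣ d l) (j : Fin m) (hj : d j ≠ 1) :
    ∃ γ : Chr k H, act e hL hl hR γ j = j ∧ orderOf γ = q := by
  letI := chrAction e hL hl hR
  have fin := finite_chr e hL hl
  haveI := Fact.mk hq
  have h : q ∣ Nat.card (MulAction.stabilizer (Chr k H) j) := stab_dvd e hL hl hR hq hqd j hj
  obtain ⟨g, hg⟩ := exists_prime_orderOf_dvd_card' q h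
  exact ⟨g.1, g.2, by rw [← hg, Subgroup.orderOf_coe]⟩

end act
end FH

end PartF

section PartG
open scoped TensorProduct
open WithConv Coalgebra HopfAlgebra

namespace FH
set_option linter.unusedSectionVars false

section drinfeld
variable {k : Type*} [Field k] {H : Type*} [Ring H] [HopfAlgebra k H]
variable {ι : Type} [Fintype ι] {a b : ι → H} (hR : IsR k a b)
variable (hSS : ∀ x : H, antipode k (antipode k x) = x)

/-- Drinfeld element -/
noncomputable def uu (k : Type*) [Field k] {H : Type*} [Ring H] [HopfAlgebra k H]
  {ι : Type} [Fintype ι] (a b : ι → H) : H := ∑ s, antipode k (b s) * a s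
/-- inverse of the Drinfeld element -/
noncomputable def vv (a b : ι → H) : H := ∑ s, b s * a s

include hR in
lemma u_eps (h : H) : ∑ i ∈ (ℛ k h).index, antipode k ((ℛ k h).right i) * (uu k a b * (ℛ k h).left i)
    = counit (R := k) h • uu k a b := by
  let M : H ⊗[k] H →ₗ[k] H := LinearMap.mul' k H ∘ₗ TensorProduct.map (antipode k) LinearMap.id ∘ₗ
    (TensorProduct.comm k H H).toLinearMap
  have hM : ∀ x y, M (x ⊗ₜ y) = antipode k y * x := by intro x y; simp [M]
  have h1 := congrArg M (hR.q4 h)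
  have h2 : M (TensorProduct.comm k H H (comul h) * ∑ s, a s ⊗ₜ[k] b s) = counit (R := k) h • uu k a b := by
    have h3 := mulS_comul (k := k) h
    rw [← (ℛ k h).eq] at h3 ⊢
    simp only [map_sum, TensorProduct.map_tmul, LinearMap.mul'_apply, LinearMap.id_apply] at h3
    rw [Finset.mul_sum, map_sum, uu, Finset.smul_sum]
    refine Finset.sum_congr rfl fun s _ => ?_
    simp only [map_sum, TensorProduct.comm_tmul, Finset.sum_mul, Algebra.TensorProduct.tmul_mul_tmul, hM,
      antipode_mul_antidistrib]
    calc _ = antipode k (b s) * (∑ i ∈ (ℛ k h).index, antipode k ((ℛ k h).left i) * (ℛ k h).right i) * a s := by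
          rw [Finset.mul_sum, Finset.sum_mul]; simp only [mul_assoc]
      _ = _ := by rw [h3, Algebra.algebraMap_eq_smul_one]; simp
  rw [h2] at h1
  rw [h1]
  conv_rhs => rw [← (ℛ k h).eq]
  rw [Finset.mul_sum, map_sum]
  refine Finset.sum_congr rfl fun i _ => ?_
  rw [uu, Finset.sum_mul, Finset.sum_mul, map_sum, Finset.mul_sum]
  refine Finset.sum_congr rfl fun s _ => ?_
  rw [Algebra.TensorProduct.tmul_mul_tmul, hM, antipode_mul_antidistrib]
  simp only [mul_assoc]

include hR hSS in
lemma u_central (h : H) : uu k a b * h = h * uu k a b := by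
  let o : H →ₗ[k] Hᵐᵒᵖ := (MulOpposite.opLinearEquiv k).toLinearMap
  have ho : ∀ x, o x = MulOpposite.op x := fun _ => rfl
  have e1 : cv (o ∘ₗ LinearMap.mulLeft k (uu k a b)) (antipodeAlgHomOp k H).toLinearMap =
      LinearMap.smulRight (counit : H →ₗ[k] k) (o (uu k a b)) := by
    ext x
    rw [cv_apply, LinearMap.smulRight_apply, ← map_smul, ← u_eps hR, map_sum]
    refine Finset.sum_congr rfl fun i _ => ?_
    simp [ho]
  have e2 := congrArg (fun X => cv X o) e1
  change cv (cv _ _) o = cv _ o at e2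
  rw [cv_assoc, opS hSS, cv_cu] at e2
  have e3 : cv (LinearMap.smulRight (counit : H →ₗ[k] k) (o (uu k a b))) o h = o (uu k a b) * o h := by
    conv_rhs => rw [← Coalgebra.sum_counit_smul (ℛ k h)]
    rw [cv_apply, map_sum, Finset.mul_sum]
    refine Finset.sum_congr rfl fun i _ => ?_
    simp
  have := LinearMap.congr_fun e2 h
  rw [e3] at this
  exact congrArg MulOpposite.unop this

include hR hSS in
lemma u_v : uu k a b * vv a b = 1 := by
  let M : H ⊗[k] H →ₗ[k] H := LinearMap.mul' k H ∘ₗ (TensorProduct.comm k H H).toLinearMap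
  have hM : ∀ x y, M (x ⊗ₜ y) = y * x := by intro x y; simp [M]
  have h1 := congrArg M (q3S2 hR)
  rw [Algebra.TensorProduct.one_def, hM, one_mul] at h1
  rw [← h1, vv, Finset.mul_sum]
  simp only [map_sum, hM]
  rw [Finset.sum_comm]
  refine Finset.sum_congr rfl fun t _ => ?_
  rw [← mul_assoc, u_central hR hSS, uu, Finset.mul_sum, Finset.sum_mul]
  simp only [mul_assoc]

/-- `∑ f(b) a` -/
noncomputable def sig (a b : ι → H) (f : H →ₗ[k] k) : H := ∑ s, f (b s) • a s

lemma Phi_chr (α : Chr k H) : Phi a b α.lin = sig a b α.lin * ell a b α.lin := by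
  rw [Phi, sig, ell, Finset.sum_mul_sum]
  simp [Chr.lin_apply, smul_smul, mul_comm]

lemma sl_mul (α : Chr k H) (X Y : H ⊗[k] H) : sl α.lin (X * Y) = sl α.lin X * sl α.lin Y := by
  induction X with
  | zero => simp
  | add x y hx hy => rw [add_mul, map_add, map_add, hx, hy, add_mul]
  | tmul x x' =>
    induction Y with
    | zero => simp
    | add x y hx hy => rw [mul_add, map_add, map_add, hx, hy, mul_add]
    | tmul y y' => simp [Chr.lin_apply, smul_smul, mul_comm]

/-- translation by `α` -/
noncomputable def TT (α : Chr k H) : H →ₗ[k] H := sl α.lin ∘ₗ comul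

lemma TT_apply (α : Chr k H) (x : H) : TT α x = sl α.lin (comul x) := rfl

lemma TT_mul (α : Chr k H) (x y : H) : TT α (x * y) = TT α x * TT α y := by
  rw [TT_apply, Bialgebra.comul_mul, sl_mul]; rfl

include hR in
lemma TT_ell (α : Chr k H) : TT α (ell a b α.lin) = α.lin (ell a b α.lin) • ell a b α.lin := by
  have := q3' hR (V := H) (LinearMap.mk₂ k (fun x Y => α.lin x • sl α.lin Y)
    (by intros; simp [add_smul]) (by intros; simp [mul_smul])
    (by intros; simp) (by intros; rw [map_smul, smul_comm]))
  simp only [LinearMap.mk₂_apply, sl_tmul] at this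
  rw [ell, map_sum, map_sum, Finset.sum_smul]
  simp only [map_smul]
  change ∑ s, α.lin (a s) • sl α.lin (comul (b s)) = _
  rw [this, Finset.sum_comm]
  refine Finset.sum_congr rfl fun t _ => ?_
  rw [Finset.smul_sum]
  refine Finset.sum_congr rfl fun s _ => ?_
  simp only [smul_smul, Chr.lin_apply, map_mul, smul_eq_mul]
  congr 1; ring

include hR in
lemma TT_v (α : Chr k H) : TT α (vv a b) =
    α.lin (ell a b α.lin) • (ell a b α.lin * vv a b * sig a b α.lin) := by
  have hA := q2' hR (V := H) (LinearMap.mk₂ k (fun X y => TT α y * sl α.lin X)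
    (by intros; simp [mul_add]) (by intros; simp)
    (by intros; simp [add_mul]) (by intros; simp))
  have hB := q3' hR (V := H) (LinearMap.mk₂ k (fun x Y => sl α.lin Y * x)
    (by intros; simp [mul_add]) (by intros; simp)
    (by intros; simp [add_mul]) (by intros; simp))
  simp only [LinearMap.mk₂_apply, sl_tmul, ← TT_apply] at hA hB
  have h1 : TT α (vv a b) = ∑ s, TT α (b s) * TT α (a s) := by
    rw [vv, map_sum]; simp only [TT_mul]
  have h2 : ∑ s, ∑ t, TT α (b s * b t) * α.lin (a s) • a t = TT α (ell a b α.lin) * ∑ t, TT α (b t) * a t := by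
    rw [ell, map_sum, Finset.sum_mul_sum]
    refine Finset.sum_congr rfl fun s _ => Finset.sum_congr rfl fun t _ => ?_
    rw [TT_mul, map_smul]; simp [mul_assoc]
  have h3 : ∑ s, ∑ t, α.lin (b t) • b s * (a s * a t) = vv a b * sig a b α.lin := by
    rw [vv, sig, Finset.sum_mul_sum]
    refine Finset.sum_congr rfl fun s _ => Finset.sum_congr rfl fun t _ => ?_
    simp [mul_assoc]
  rw [h1, hA, h2, hB, h3, TT_ell hR, smul_mul_assoc, mul_assoc]

end drinfeld

section bichar
variable {k : Type*} [Field k] [CharZero k] {H : Type*} [Ring H] [HopfAlgebra k H] [FiniteDimensional k H]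
variable {m : ℕ} {d : Fin m → ℕ} [hd : ∀ i, NeZero (d i)]
variable (e : H ≃ₐ[k] ((i : Fin m) → Matrix (Fin (d i)) (Fin (d i)) k))
variable {L : H} (hL : IsInt k L) {lam : H →ₗ[k] k} (hl : IsCoint lam)
variable {ι : Type} [Fintype ι] {a b : ι → H} (hR : IsR k a b)

include hL hl hR

/-- the pairing between characters and irreducibles -/
noncomputable def bb (j : Fin m) : Chr k H →* k where
  toFun γ := ww e j (Phi a b γ.lin)
  map_one' := by rw [Chr.one_lin, Phi_counit hR, ww_one]
  map_mul' γ δ := by rw [Chr.mul_lin, psi_cv e hL hl hR γ.tr]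

lemma bb_apply (j : Fin m) (γ : Chr k H) : bb e hL hl hR j γ = ww e j (Phi a b γ.lin) := rfl

lemma bb_ne (j : Fin m) (γ : Chr k H) : bb e hL hl hR j γ ≠ 0 := by
  intro h
  have := map_mul (bb e hL hl hR j) γ γ⁻¹
  rw [mul_inv_cancel, map_one, h, zero_mul] at this
  exact one_ne_zero this

lemma bb_act (γ β : Chr k H) (j : Fin m) :
    bb e hL hl hR (act e hL hl hR β j) γ = β.lin (Phi a b γ.lin) * bb e hL hl hR j γ := by
  have h1 : chi e (act e hL hl hR β j) (Phi a b γ.lin) = β.lin (Phi a b γ.lin) * chi e j (Phi a b γ.lin) := by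
    rw [← act_spec, Phi_symm (β.tr.cv (chi_tr e j)) γ.tr, Phi_cv hR (Phi_tr_central hL hl hR β.tr),
      Phi_symm β.tr γ.tr, Phi_symm (chi_tr e j) γ.tr, Chr.lin_apply, map_mul]
    rfl
  rw [bb_apply, bb_apply, ww, h1, act_d e hL hl hR, ww, mul_div_assoc]

lemma stab_pair {α : Chr k H} {j : Fin m} (h : act e hL hl hR α j = j) (γ : Chr k H) :
    α.lin (Phi a b γ.lin) = 1 := by
  have := bb_act e hL hl hR γ α j
  rw [h] at this
  exact mul_right_cancel₀ (bb_ne e hL hl hR j γ) (by rw [← this, one_mul])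

lemma stab_bb {q : ℕ} (hq : Odd q) {α : Chr k H} {j : Fin m} (h : act e hL hl hR α j = j) (ho : orderOf α = q) :
    bb e hL hl hR j α = 1 := by
  set r := α.lin (ell a b α.lin) with hr
  have hu := u_central hR (SS hL hl)
  have hv : chi e j (vv a b) ≠ 0 := by
    intro h0
    have := chi_central_mul e hu j (vv a b)
    rw [u_v hR (SS hL hl), h0, mul_zero, chi_one] at this
    exact d_ne (k := k) j this
  have h1 : chi e j (vv a b) = r * (bb e hL hl hR j α * chi e j (vv a b)) := by
    have e1 : chi e j (TT α (vv a b)) = chi e j (vv a b) := by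
      rw [TT_apply, f_sl, act_spec e hL hl hR, h]
    conv_lhs => rw [← e1]
    rw [TT_v hR, map_smul, mul_assoc, chi_tr e j, mul_assoc, ← Phi_chr,
      ← Phi_tr_central hL hl hR α.tr, chi_central_mul e (Phi_tr_central hL hl hR α.tr)]
    rfl
  have h2 : r * bb e hL hl hR j α = 1 :=
    mul_right_cancel₀ hv (by rw [mul_assoc, ← h1, one_mul])
  have h3 : r ^ 2 = 1 := by
    have := stab_pair e hL hl hR h α
    rw [Phi_chr, Chr.lin_apply, map_mul] at this
    have hs : α.hom (sig a b α.lin) = r := by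
      rw [hr, sig, ell, map_sum, map_sum]
      exact Finset.sum_congr rfl fun s _ => by simp [Chr.lin_apply, mul_comm]
    rw [hs] at this
    rw [sq]; exact this
  have h4 : bb e hL hl hR j α ^ q = 1 := by
    rw [← map_pow, ← ho, pow_orderOf_eq_one, map_one]
  have h5 : bb e hL hl hR j α ^ 2 = 1 := by
    have : (r * bb e hL hl hR j α) ^ 2 = 1 := by rw [h2, one_pow]
    rw [mul_pow, h3, one_mul] at this; exact this
  obtain ⟨c, hc⟩ := hq
  rw [hc, pow_succ, pow_mul, h5, one_pow, one_mul] at h4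
  exact h4

lemma chr_L {γ : Chr k H} (h : γ ≠ 1) : γ.lin L = 0 := by
  by_contra hne
  apply h
  apply Chr.lin_inj
  ext x
  have := congrArg γ.lin (hL.left x)
  rw [Chr.lin_apply, map_mul, map_smul, smul_eq_mul] at this
  exact mul_right_cancel₀ hne this

open Classical in
lemma sum_bb (hP : Phi a b lam = L) (γ : Chr k H) :
    ∑ i, (d i : k) ^ 2 * bb e hL hl hR i γ = if γ = 1 then (Module.finrank k H : k) else 0 := by
  have h1 : creg k H (Phi a b γ.lin) = ∑ i, (d i : k) ^ 2 * bb e hL hl hR i γ := by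
    rw [creg_chi e, LinearMap.sum_apply]
    refine Finset.sum_congr rfl fun i _ => ?_
    rw [LinearMap.smul_apply, chi_eq_ww, smul_eq_mul, bb_apply]; ring
  rw [← h1, Phi_symm (creg_mul_comm (k := k)) γ.tr, creg_eq hL hl, Phi_smul, hP, map_smul]
  split_ifs with h
  · rw [h, Chr.one_lin, hL.one, smul_eq_mul, mul_one]
  · rw [chr_L hL hl hR h, smul_zero]

lemma bb_eq_one (hb : Function.Bijective (Phi (k := k) a b)) {γ : Chr k H} (h : ∀ j, bb e hL hl hR j γ = 1) : γ = 1 := by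
  apply Chr.lin_inj
  apply hb.1
  rw [Chr.one_lin, Phi_counit hR]
  exact ww_ext e (Phi_tr_central hL hl hR γ.tr) (by simp) (fun i => by rw [ww_one]; exact h i)

end bichar
end FH

end PartG

section PartI
open scoped TensorProduct
open WithConv Coalgebra HopfAlgebra

namespace FH
set_option linter.unusedSectionVars false

section final
variable {k : Type*} [Field k] [CharZero k] {H : Type*} [Ring H] [HopfAlgebra k H] [FiniteDimensional k H]
variable {m : ℕ} {d : Fin m → ℕ} [hd : ∀ i, NeZero (d i)]
variable (e : H ≃ₐ[k] ((i : Fin m) → Matrix (Fin (d i)) (Fin (d i)) k))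
variable {L : H} (hL : IsInt k L) {lam : H →ₗ[k] k} (hl : IsCoint lam)
variable {ι : Type} [Fintype ι] {a b : ι → H} (hR : IsR k a b)

include hL hl hR

/-- characters which pair trivially with all characters -/
noncomputable def KK : Subgroup (Chr k H) where
  carrier := {δ | ∀ Z γ, bb e hL hl hR (act e hL hl hR δ Z) γ = bb e hL hl hR Z γ}
  one_mem' Z γ := by rw [act_one]
  mul_mem' {x y} hx hy Z γ := by rw [act_mul, hx, hy]
  inv_mem' {x} hx Z γ := by
    rw [← hx, ← act_mul, mul_inv_cancel, act_one]

lemma stab_KK {α : Chr k H} {j : Fin m} (h : act e hL hl hR α j = j) : α ∈ KK e hL hl hR := by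
  intro Z γ
  rw [bb_act, stab_pair e hL hl hR h, one_mul]

lemma bb_inv {α : Chr k H} {j Z : Fin m} (h : act e hL hl hR α j = j) (hZ : d Z = 1) : bb e hL hl hR Z α = 1 := by
  rw [bb_apply, ww, ← gam_lin e Z hZ, Phi_symm (Chr.tr _) α.tr, stab_pair e hL hl hR h, hZ]
  simp

lemma card_formula (hP : Phi a b lam = L) (B : Subgroup (Chr k H)) (Z0 : Fin m) (I : Finset (Fin m))
    (hI : ∀ i, i ∈ I ↔ ∀ β ∈ B, bb e hL hl hR i β = bb e hL hl hR Z0 β) :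
    Module.finrank k H = Nat.card B * ∑ i ∈ I, d i ^ 2 := by
  classical
  letI cg : CommGroup (Chr k H) := { (inferInstance : Group (Chr k H)) with mul_comm := chr_comm hR }
  have fin := finite_chr e hL hl
  letI := Fintype.ofFinite (Chr k H)
  letI := Fintype.ofFinite B
  let f : Fin m → (B →* k) := fun i =>
    ((bb e hL hl hR i) * (bb e hL hl hR Z0).comp invMonoidHom).comp B.subtype
  have hf : ∀ i (β : B), f i β = bb e hL hl hR i β.1 * bb e hL hl hR Z0 β.1⁻¹ := fun i β => rfl
  have hinv : ∀ β : Chr k H, bb e hL hl hR Z0 β * bb e hL hl hR Z0 β⁻¹ = 1 := by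
    intro β; rw [← map_mul, mul_inv_cancel, map_one]
  have hf1 : ∀ i, f i = 1 ↔ i ∈ I := by
    intro i
    rw [hI]
    constructor
    · intro h β hβ
      have h1 : f i ⟨β, hβ⟩ = 1 := by rw [h]; rfl
      rw [hf] at h1
      have h2 := hinv β
      exact mul_right_cancel₀ (bb_ne e hL hl hR Z0 β⁻¹) (h1.trans h2.symm)
    · intro h
      ext β
      rw [hf, h _ β.2, hinv]; rfl
  have h1 : ∑ β : B, bb e hL hl hR Z0 β.1⁻¹ * ∑ i, (d i : k) ^ 2 * bb e hL hl hR i β.1 = Module.finrank k H := by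
    rw [Finset.sum_eq_single (1 : B)]
    · rw [sum_bb e hL hl hR hP, if_pos (by rfl)]; simp
    · intro β _ hne
      rw [sum_bb e hL hl hR hP, if_neg (by simpa using hne), mul_zero]
    · simp
  have h2 : ∑ β : B, bb e hL hl hR Z0 β.1⁻¹ * ∑ i, (d i : k) ^ 2 * bb e hL hl hR i β.1 =
      ∑ i, (d i : k) ^ 2 * ∑ β, f i β := by
    simp only [Finset.mul_sum]
    rw [Finset.sum_comm]
    refine Finset.sum_congr rfl fun i _ => Finset.sum_congr rfl fun β _ => ?_
    rw [hf]; ring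
  have h3 : ∑ i, (d i : k) ^ 2 * ∑ β, f i β = ((Nat.card B * ∑ i ∈ I, d i ^ 2 : ℕ) : k) := by
    simp only [sum_hom_units, hf1]
    push_cast
    rw [Finset.mul_sum, ← Finset.sum_filter_add_sum_filter_not Finset.univ (fun i => i ∈ I)]
    rw [Finset.filter_mem_eq_inter, Finset.univ_inter]
    rw [Finset.sum_eq_zero (s := Finset.univ.filter fun i => ¬ i ∈ I), add_zero]
    · refine Finset.sum_congr rfl fun i hi => ?_
      rw [if_pos hi, mul_comm, Nat.card_eq_fintype_card]
    · intro i hi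
      rw [if_neg (Finset.mem_filter.1 hi).2]; simp
  have h4 := h1.symm.trans (h2.trans h3)
  exact_mod_cast h4

lemma orbit_dvd {q : ℕ} (hq : q.Prime) (hodd : Odd q) (B : Subgroup (Chr k H)) (hB : B ≤ KK e hL hl hR)
    (hBq : IsPGroup q B)
    {α : Chr k H} (hα : α ∈ B) (ho : orderOf α = q) (n : ℕ) (Z0 : Fin m) (hZ0 : bb e hL hl hR Z0 α ≠ 1)
    (I : Finset (Fin m)) (hI : ∀ i, i ∈ I ↔ ∀ β ∈ B, bb e hL hl hR i β = bb e hL hl hR Z0 β) :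
    q ∣ (I.filter fun i => d i = n).card := by
  classical
  have fin := finite_chr e hL hl
  haveI := Fact.mk hq
  let X := {i : Fin m // i ∈ I.filter fun i => d i = n}
  letI : MulAction B X :=
    { smul := fun β x => ⟨act e hL hl hR β.1 x.1, by
        have hx := Finset.mem_filter.1 x.2
        refine Finset.mem_filter.2 ⟨(hI _).2 fun δ hδ => ?_, ?_⟩
        · rw [hB β.2, (hI _).1 hx.1 δ hδ]
        · rw [act_d e hL hl hR]; exact hx.2⟩
      one_smul := fun x => Subtype.ext (act_one e hL hl hR x.1)
      mul_smul := fun β γ x => Subtype.ext (act_mul e hL hl hR β.1 γ.1 x.1) }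
  have h := hBq.card_modEq_card_fixedPoints X
  have h0 : IsEmpty (MulAction.fixedPoints B X) := by
    constructor
    rintro ⟨x, hx⟩
    have h1 : act e hL hl hR α x.1 = x.1 := congrArg Subtype.val (hx ⟨α, hα⟩)
    have h2 := stab_bb e hL hl hR hodd h1 ho
    rw [(hI _).1 (Finset.mem_filter.1 x.2).1 α hα] at h2
    exact hZ0 h2
  rw [Nat.card_of_isEmpty (α := MulAction.fixedPoints B X), Nat.modEq_zero_iff_dvd] at h
  have hX : Nat.card X = (I.filter fun i => d i = n).card := by
    rw [Nat.card_eq_fintype_card, Fintype.card_coe]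
  rwa [hX] at h

include e in
theorem all_one (hP : Phi a b lam = L) (hb : Function.Bijective (Phi (k := k) a b))
    {q : ℕ} (hq : q.Prime) (hodd : Odd q) (hqd : ∀ l, d l ≠ 1 → q ∣ d l)
    (h5 : ¬ q ^ 5 ∣ Module.finrank k H) (l : Fin m) : d l = 1 := by
  classical
  by_contra hj0
  letI cg : CommGroup (Chr k H) := { (inferInstance : Group (Chr k H)) with mul_comm := chr_comm hR }
  have fin := finite_chr e hL hl
  haveI := Fact.mk hq
  obtain ⟨α, hα, hαo⟩ := stab_order e hL hl hR hq hqd l hj0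
  have hα1 : α ≠ 1 := by
    rintro rfl
    rw [orderOf_one] at hαo
    exact hq.one_lt.ne hαo
  obtain ⟨Z0, hZ0⟩ : ∃ Z0, bb e hL hl hR Z0 α ≠ 1 := by
    by_contra! hc
    exact hα1 (bb_eq_one e hL hl hR hb hc)
  have hnon : ∀ Z, bb e hL hl hR Z α ≠ 1 → d Z ≠ 1 := fun Z hZ hdZ => hZ (bb_inv e hL hl hR hα hdZ)
  obtain ⟨β, hβ, hβo⟩ := stab_order e hL hl hR hq hqd Z0 (hnon Z0 hZ0)
  have hβ1 := stab_bb e hL hl hR hodd hβ hβo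
  let B : Subgroup (Chr k H) := Subgroup.zpowers α ⊔ Subgroup.zpowers β
  have hαB : α ∈ B := (le_sup_left : Subgroup.zpowers α ≤ B) (Subgroup.mem_zpowers α)
  have hβB : β ∈ B := (le_sup_right : Subgroup.zpowers β ≤ B) (Subgroup.mem_zpowers β)
  have hB : B ≤ KK e hL hl hR := by
    refine sup_le ?_ ?_
    · rw [Subgroup.zpowers_le]; exact stab_KK e hL hl hR hα
    · rw [Subgroup.zpowers_le]; exact stab_KK e hL hl hR hβ
  have hzp : ∀ γ : Chr k H, orderOf γ = q → IsPGroup q (Subgroup.zpowers γ) := by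
    intro γ hγ
    refine IsPGroup.of_card (n := 1) ?_
    rw [Nat.card_zpowers, hγ, pow_one]
  have hBq : IsPGroup q B := (hzp α hαo).to_sup_of_normal_right (hzp β hβo)
  have hcard : q ^ 2 ∣ Nat.card B := by
    obtain ⟨s, hs⟩ := (IsPGroup.iff_card).1 hBq
    rw [hs]
    apply pow_dvd_pow
    by_contra! hlt
    have hle : Nat.card B ≤ Nat.card (Subgroup.zpowers β) := by
      rw [hs, Nat.card_zpowers, hβo]
      calc q ^ s ≤ q ^ 1 := Nat.pow_le_pow_right hq.pos (by omega)
        _ = q := pow_one q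
    have heq : Subgroup.zpowers β = B := Subgroup.eq_of_le_of_card_ge le_sup_right hle
    rw [← heq] at hαB
    obtain ⟨c, hc⟩ := Subgroup.mem_zpowers_iff.1 hαB
    have hmem : α ∈ Submonoid.powers β := by
      rw [← mem_powers_iff_mem_zpowers] at hαB; exact hαB
    obtain ⟨c, hc⟩ := hmem
    apply hZ0
    rw [← hc]
    change bb e hL hl hR Z0 (β ^ c) = 1
    rw [map_pow, hβ1, one_pow]
  let I : Finset (Fin m) := Finset.univ.filter fun i => ∀ β ∈ B, bb e hL hl hR i β = bb e hL hl hR Z0 β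
  have hI : ∀ i, i ∈ I ↔ ∀ β ∈ B, bb e hL hl hR i β = bb e hL hl hR Z0 β := by
    intro i; simp [I]
  have hsum : q ^ 3 ∣ ∑ i ∈ I, d i ^ 2 := by
    rw [Finset.sum_comp (fun n => n ^ 2) d]
    refine Finset.dvd_sum fun n hn => ?_
    obtain ⟨i, hi, rfl⟩ := Finset.mem_image.1 hn
    have h1 : q ∣ d i := hqd i (hnon i (by rw [(hI i).1 hi α hαB]; exact hZ0))
    have h2 := orbit_dvd e hL hl hR hq hodd B hB hBq hαB hαo (d i) Z0 hZ0 I hI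
    rw [smul_eq_mul, pow_succ', ]
    exact mul_dvd_mul h2 (pow_dvd_pow_of_dvd h1 2)
  apply h5
  rw [card_formula e hL hl hR hP B Z0 I hI, show q ^ 5 = q ^ 2 * q ^ 3 by ring]
  exact mul_dvd_mul hcard hsum

end final
end FH

end PartI

section PartJ
open scoped TensorProduct
open WithConv Coalgebra HopfAlgebra

namespace FH

section dual
variable (k : Type*) [Field k] (G : Type*) [Monoid G] [Fintype G]

noncomputable def dualTT : (G → k) ⊗[k] (G → k) ≃ₗ[k] (G × G → k) :=
  (TensorProduct.congr (Finsupp.linearEquivFunOnFinite k k G)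
      (Finsupp.linearEquivFunOnFinite k k G)).symm.trans
    ((finsuppTensorFinsupp' k G G).trans (Finsupp.linearEquivFunOnFinite k k (G × G)))

lemma dualTT_tmul (u v : G → k) (p : G × G) : dualTT k G (u ⊗ₜ v) p = u p.1 * v p.2 := by
  simp only [dualTT, LinearEquiv.trans_apply, TensorProduct.congr_symm_tmul,
    Finsupp.linearEquivFunOnFinite_apply]
  exact finsuppTensorFinsupp'_apply_apply k G G _ _ p.1 p.2

lemma dualTT_dualComul (f : G → k) (p : G × G) : dualTT k G (dualComul k G f) p = f (p.1 * p.2) := by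
  simp only [dualTT, dualComul, LinearEquiv.trans_apply, LinearMap.comp_apply, LinearEquiv.coe_coe,
    LinearEquiv.symm_apply_apply, LinearEquiv.apply_symm_apply]
  rfl

end dual

section final2
variable {k : Type*} [Field k] [CharZero k] {H : Type*} [Ring H] [HopfAlgebra k H] [FiniteDimensional k H]
variable {m : ℕ} {d : Fin m → ℕ} [hd : ∀ i, NeZero (d i)]
variable (e : H ≃ₐ[k] ((i : Fin m) → Matrix (Fin (d i)) (Fin (d i)) k))
variable {L : H} (hL : IsInt k L) {lam : H →ₗ[k] k} (hl : IsCoint lam)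
variable {ι : Type} [Fintype ι] {a b : ι → H} (hR : IsR k a b)

include e hL hl hR in
theorem conclude (h1 : ∀ l, d l = 1) : ∃ (G : Type) (_ : CommGroup G) (_ : Fintype G),
      Fintype.card G = Module.finrank k H ∧
        ∃ e : H ≃ₐ[k] (G → k), IsDualGroupAlgebraIso k H G e := by
  classical
  letI cg : CommGroup (Chr k H) := { (inferInstance : Group (Chr k H)) with mul_comm := chr_comm hR }
  let E := gamEquiv e hL hl
  letI cG : CommGroup {l : Fin m // d l = 1} := E.commGroup
  have hcard : Fintype.card {l : Fin m // d l = 1} = Module.finrank k H := by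
    rw [sum_sq e, Fintype.card_subtype]
    simp [h1]
  let P : H →ₐ[k] ({l : Fin m // d l = 1} → k) := AlgHom.pi (fun g => (E g).hom)
  have hP : ∀ x g, P x g = (E g).lin x := fun x g => rfl
  have hinj : Function.Injective P := by
    rw [injective_iff_map_eq_zero]
    intro x hx
    rw [← map_eq_zero_iff e e.injective]
    funext l
    have h2 := congrFun hx ⟨l, h1 l⟩
    have h3 : (gam e l (h1 l)).lin x = 0 := h2
    rw [gam_lin, chi_apply] at h3
    rw [Pi.zero_apply]
    generalize e x l = M at h3 ⊢
    clear h2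
    have h4 := h1 l
    generalize d l = n at M h4
    subst h4
    ext i j
    fin_cases i; fin_cases j
    simpa [Matrix.trace_fin_one] using h3
  have hbij : Function.Bijective P := by
    refine ⟨hinj, ?_⟩
    exact (LinearMap.injective_iff_surjective_of_finrank_eq_finrank (f := P.toLinearMap)
      (by rw [Module.finrank_fintype_fun_eq_card, hcard])).1 hinj
  refine ⟨{l : Fin m // d l = 1}, cG, inferInstance, hcard, AlgEquiv.ofBijective P hbij, ?_, ?_⟩
  · intro x
    apply (dualTT k _).injective
    funext p
    rw [dualTT_dualComul]
    change _ = (E (p.1 * p.2)).lin x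
    have h5 : E (p.1 * p.2) = E p.1 * E p.2 := E.apply_symm_apply _
    rw [h5, Chr.mul_lin, cv_apply]
    conv_lhs => rw [← (ℛ k x).eq]
    rw [map_sum, map_sum, Finset.sum_apply]
    refine Finset.sum_congr rfl fun i _ => ?_
    rw [TensorProduct.map_tmul, dualTT_tmul]
    rfl
  · intro x
    change _ = (E 1).lin x
    have h5 : E 1 = 1 := E.apply_symm_apply _
    rw [h5, Chr.one_lin]

end final2

theorem main (k : Type*) [Field k] [IsAlgClosed k]
    [CharZero k] (H : Type*) [Ring H] [HopfAlgebra k H] [FiniteDimensional k H]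
    (hss : IsSemisimpleRing H)
    (R : H ⊗[k] H) (hR : IsRMatrixFor (Coalgebra.comul : H →ₗ[k] H ⊗[k] H) R)
    (hfact : Function.Bijective fun f : Module.Dual k H =>
      (TensorProduct.lid k H)
        (TensorProduct.map f LinearMap.id ((TensorProduct.comm k H H) R * R)))
    (q d n : ℕ) (hq : q.Prime) (hq2 : 2 < q) (hsf : Squarefree d)
    (hn : n ≤ 3) (hdim : Module.finrank k H = d * q ^ n) :
    ∃ (G : Type) (_ : CommGroup G) (_ : Fintype G),
      Fintype.card G = d * q ^ n ∧
        ∃ e : H ≃ₐ[k] (G → k), IsDualGroupAlgebraIso k H G e := by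
  obtain ⟨L, hL1, hL2, hL3⟩ := exists_integral (k := k) (H := H)
  have hL : IsInt k L := ⟨hL1, hL2, hL3⟩
  obtain ⟨m, δ, hδ, ⟨e⟩⟩ := IsSemisimpleRing.exists_algEquiv_pi_matrix_of_isAlgClosed k H
  obtain ⟨N, a, b, rfl, hab⟩ := exists_isR hR
  have hb : Function.Bijective (Phi (k := k) a b) := by
    convert hfact using 1
    funext f
    exact Phi_eq f
  obtain ⟨lam, hl, hP⟩ := exists_coint hab hb hL
  have hodd : Odd q := hq.odd_of_ne_two (by omega)
  have hqd : ∀ l, δ l ≠ 1 → q ∣ δ l := by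
    intro l hl1
    by_contra hnd
    apply hl1
    have h := dim_dvd e hL hl hab hP l
    rw [hdim] at h
    have hc : Nat.Coprime (δ l ^ 2) (q ^ n) :=
      Nat.Coprime.pow _ _ ((Nat.Prime.coprime_iff_not_dvd hq).2 hnd).symm
    have h2 := hc.dvd_of_dvd_mul_right h
    rw [sq] at h2
    exact Nat.isUnit_iff.1 (hsf _ h2)
  have h5 : ¬ q ^ 5 ∣ Module.finrank k H := by
    intro h
    rw [hdim] at h
    have h2 : q ^ 2 * q ^ n ∣ d * q ^ n := by
      rw [← pow_add]
      exact (pow_dvd_pow q (by omega)).trans h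
    have h3 := Nat.dvd_of_mul_dvd_mul_right (pow_pos hq.pos n) h2
    rw [sq] at h3
    have := Nat.isUnit_iff.1 (hsf _ h3)
    omega
  have := conclude e hL hl hab (all_one e hL hl hab hP hb hq hodd hqd h5)
  rwa [hdim] at this

end FH

end PartJ

/-- Let `q > 2` be a prime, `d` an odd square-free natural
number, `n ≤ 3`, and `H` a semisimple factorizable Hopf algebra of dimension
`d * q ^ n` over an algebraically closed field of characteristic `0`.  Then `H`
is isomorphic, as a Hopf algebra, to the dual group algebra `k^G` of a finite
abelian group `G` of order `d * q ^ n`. -/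
theorem factorizable_is_dual_group_algebra (k : Type*) [Field k] [IsAlgClosed k]
    [CharZero k] (H : Type*) [Ring H] [HopfAlgebra k H] [FiniteDimensional k H]
    (hss : IsSemisimpleRing H)
    (R : H ⊗[k] H) (hR : IsRMatrixFor (Coalgebra.comul : H →ₗ[k] H ⊗[k] H) R)
    (hfact : Function.Bijective fun f : Module.Dual k H =>
      (TensorProduct.lid k H)
        (TensorProduct.map f LinearMap.id ((TensorProduct.comm k H H) R * R)))
    (q d n : ℕ) (hq : q.Prime) (hq2 : 2 < q) (hd : Odd d) (hsf : Squarefree d)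
    (hn : n ≤ 3) (hdim : Module.finrank k H = d * q ^ n) :
    ∃ (G : Type) (_ : CommGroup G) (_ : Fintype G),
      Fintype.card G = d * q ^ n ∧
        ∃ e : H ≃ₐ[k] (G → k), IsDualGroupAlgebraIso k H G e := by
  exact FH.main k H hss R hR hfact q d n hq hq2 hsf hn hdim
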